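/- arXiv:2005.00466 — 8 statements merged into one kernel-verified Lean document; each statement's English description precedes it below -/
import Mathlib

section
/- Suppose ω ∈ 𝒯_{r*} for some r* ∈ ℛ. Then the adaptive validation regularization parameter satisfies r̂(ω) ≤ r*. (First conclusion of the finite-sample bound for adaptive validation, in its deterministic on-event form.) -/
open MeasureTheory

/-- On the event `𝒯 r*`, the adaptive validation regularization parameter
satisfies `r̂(ω) ≤ r*`. -/
theorem stmt_1
    {𝕊 : Type*} (Θ : 𝕊) (ℓ : 𝕊 → 𝕊 → ℝ)
    (hℓ_nonneg : ∀ a b, 0 ≤ ℓ a b)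
    (hℓ_symm : ∀ a b, ℓ a b = ℓ b a)
    (hℓ_tri : ∀ a b c, ℓ a c ≤ ℓ a b + ℓ b c)
    (R : Finset ℝ) (hR : R.Nonempty)
    (k : ℝ → ℝ) (hk_pos : ∀ r, 0 < k r) (hk_mono : Monotone k)
    {Ω : Type*} [MeasurableSpace Ω]
    (P : Measure Ω) [IsProbabilityMeasure P]
    (ThetaHat : ℝ → Ω → 𝕊) (T : ℝ → Set Ω)
    (hT_meas : ∀ r ∈ R, MeasurableSet (T r))
    (hT_mono : ∀ r' ∈ R, ∀ r'' ∈ R, r' ≤ r'' → T r' ⊆ T r'')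
    (hT_bound : ∀ r ∈ R, ∀ ω ∈ T r, ℓ Θ (ThetaHat r ω) ≤ k r)
    (rhat : Ω → ℝ)
    (hrhat : ∀ ω : Ω, IsLeast
      {r ∈ (↑R : Set ℝ) | ∀ r' ∈ R, ∀ r'' ∈ R, r ≤ r' → r ≤ r'' →
        ℓ (ThetaHat r' ω) (ThetaHat r'' ω) ≤ k r' + k r''} (rhat ω))
    (rstar : ℝ) (hrstar : rstar ∈ R) (ω : Ω) (hω : ω ∈ T rstar) :
    rhat ω ≤ rstar := by
  refine (hrhat ω).2 ⟨hrstar, ?_⟩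
  intro r' h' r'' h'' hl' hl''
  have h1 := hT_bound r' h' ω (hT_mono rstar hrstar r' h' hl' hω)
  have h2 := hT_bound r'' h'' ω (hT_mono rstar hrstar r'' h'' hl'' hω)
  have h3 := hℓ_tri (ThetaHat r' ω) Θ (ThetaHat r'' ω)
  rw [hℓ_symm (ThetaHat r' ω) Θ] at h3
  linarith
end

section
/- Suppose ω ∈ 𝒯_{r*} for some r* ∈ ℛ. Then r̂(ω) ≤ r* and ℓ(Θ, Θ̂_{r̂(ω)}(ω)) ≤ 3·k(r*). (Deterministic, on-event form of the finite-sample bound for the adaptive validation estimator, Theorem 3 of the supplement.) -/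
open MeasureTheory

/-- Deterministic, on-event form of the finite-sample bound for the adaptive
validation estimator: on `𝒯 r*`, `r̂(ω) ≤ r*` and `ℓ(Θ, Θ̂_{r̂(ω)}(ω)) ≤ 3 k(r*)`. -/
theorem stmt_3
    {𝕊 : Type*} (Θ : 𝕊) (ℓ : 𝕊 → 𝕊 → ℝ)
    (hℓ_nonneg : ∀ a b, 0 ≤ ℓ a b)
    (hℓ_symm : ∀ a b, ℓ a b = ℓ b a)
    (hℓ_tri : ∀ a b c, ℓ a c ≤ ℓ a b + ℓ b c)
    (R : Finset ℝ) (hR : R.Nonempty)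
    (k : ℝ → ℝ) (hk_pos : ∀ r, 0 < k r) (hk_mono : Monotone k)
    {Ω : Type*} [MeasurableSpace Ω]
    (P : Measure Ω) [IsProbabilityMeasure P]
    (ThetaHat : ℝ → Ω → 𝕊) (T : ℝ → Set Ω)
    (hT_meas : ∀ r ∈ R, MeasurableSet (T r))
    (hT_mono : ∀ r' ∈ R, ∀ r'' ∈ R, r' ≤ r'' → T r' ⊆ T r'')
    (hT_bound : ∀ r ∈ R, ∀ ω ∈ T r, ℓ Θ (ThetaHat r ω) ≤ k r)
    (rhat : Ω → ℝ)
    (hrhat : ∀ ω : Ω, IsLeast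
      {r ∈ (↑R : Set ℝ) | ∀ r' ∈ R, ∀ r'' ∈ R, r ≤ r' → r ≤ r'' →
        ℓ (ThetaHat r' ω) (ThetaHat r'' ω) ≤ k r' + k r''} (rhat ω))
    (rstar : ℝ) (hrstar : rstar ∈ R) (ω : Ω) (hω : ω ∈ T rstar) :
    rhat ω ≤ rstar ∧ ℓ Θ (ThetaHat (rhat ω) ω) ≤ 3 * k rstar := by
  have hb : ∀ r ∈ R, rstar ≤ r → ℓ Θ (ThetaHat r ω) ≤ k r := fun r hr h =>
    hT_bound r hr ω (hT_mono rstar hrstar r hr h hω)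
  have hle : rhat ω ≤ rstar := by
    refine (hrhat ω).2 ⟨hrstar, fun r' hr' r'' hr'' h' h'' => ?_⟩
    have h1 := hℓ_tri (ThetaHat r' ω) Θ (ThetaHat r'' ω)
    rw [hℓ_symm (ThetaHat r' ω) Θ] at h1
    linarith [hb r' hr' h', hb r'' hr'' h'']
  refine ⟨hle, ?_⟩
  have hmem : rhat ω ∈ R := (hrhat ω).1.1
  have h2 := (hrhat ω).1.2 rstar hrstar (rhat ω) hmem hle le_rfl
  linarith [hℓ_tri Θ (ThetaHat rstar ω) (ThetaHat (rhat ω) ω), hb rstar hrstar le_rfl, hk_mono hle]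
end

section
/- Let δ ∈ (0,1] and let r*_δ ∈ ℛ satisfy ℙ(𝒯_{r*_δ}) ≥ 1 − δ. Then there exists a measurable event A with ℙ(A) ≥ 1 − δ such that for every ω ∈ A one has r̂(ω) ≤ r*_δ and ℓ(Θ, Θ̂_{r̂(ω)}(ω)) ≤ 3·k(r*_δ). (Finite-sample bound for the adaptive validation estimator with general regularization-to-loss function k; Theorem 3 of the supplement.) -/
open MeasureTheory

/-- Finite-sample bound for the adaptive validation estimator with a general
regularization-to-loss function `k`: if `ℙ(𝒯_{r*_δ}) ≥ 1 − δ`, then there is a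
measurable event `A` with `ℙ(A) ≥ 1 − δ` on which `r̂(ω) ≤ r*_δ` and
`ℓ(Θ, Θ̂_{r̂(ω)}(ω)) ≤ 3 k(r*_δ)`. -/
theorem stmt_4
    {𝕊 : Type*} (Θ : 𝕊) (ℓ : 𝕊 → 𝕊 → ℝ)
    (hℓ_nonneg : ∀ a b, 0 ≤ ℓ a b)
    (hℓ_symm : ∀ a b, ℓ a b = ℓ b a)
    (hℓ_tri : ∀ a b c, ℓ a c ≤ ℓ a b + ℓ b c)
    (R : Finset ℝ) (hR : R.Nonempty)
    (k : ℝ → ℝ) (hk_pos : ∀ r, 0 < k r) (hk_mono : Monotone k)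
    {Ω : Type*} [MeasurableSpace Ω]
    (P : Measure Ω) [IsProbabilityMeasure P]
    (ThetaHat : ℝ → Ω → 𝕊) (T : ℝ → Set Ω)
    (hT_meas : ∀ r ∈ R, MeasurableSet (T r))
    (hT_mono : ∀ r' ∈ R, ∀ r'' ∈ R, r' ≤ r'' → T r' ⊆ T r'')
    (hT_bound : ∀ r ∈ R, ∀ ω ∈ T r, ℓ Θ (ThetaHat r ω) ≤ k r)
    (rhat : Ω → ℝ)
    (hrhat : ∀ ω : Ω, IsLeast
      {r ∈ (↑R : Set ℝ) | ∀ r' ∈ R, ∀ r'' ∈ R, r ≤ r' → r ≤ r'' →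
        ℓ (ThetaHat r' ω) (ThetaHat r'' ω) ≤ k r' + k r''} (rhat ω))
    (δ : ℝ) (hδ : δ ∈ Set.Ioc (0 : ℝ) 1)
    (rstar : ℝ) (hrstar : rstar ∈ R)
    (hP : 1 - ENNReal.ofReal δ ≤ P (T rstar)) :
    ∃ A : Set Ω, MeasurableSet A ∧ 1 - ENNReal.ofReal δ ≤ P A ∧
      ∀ ω ∈ A, rhat ω ≤ rstar ∧ ℓ Θ (ThetaHat (rhat ω) ω) ≤ 3 * k rstar := by
  refine ⟨T rstar, hT_meas rstar hrstar, hP, fun ω hω => ?_⟩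
  have hle : rhat ω ≤ rstar := by
    refine (hrhat ω).2 ⟨hrstar, fun r' hr' r'' hr'' h1 h2 => ?_⟩
    have b1 := hT_bound r' hr' ω (hT_mono rstar hrstar r' hr' h1 hω)
    have b2 := hT_bound r'' hr'' ω (hT_mono rstar hrstar r'' hr'' h2 hω)
    have t := hℓ_tri (ThetaHat r' ω) Θ (ThetaHat r'' ω)
    rw [hℓ_symm (ThetaHat r' ω) Θ] at t
    linarith
  refine ⟨hle, ?_⟩
  obtain ⟨hmem, hc⟩ := (hrhat ω).1
  have c := hc rstar hrstar (rhat ω) hmem hle le_rfl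
  have b := hT_bound rstar hrstar ω hω
  have t := hℓ_tri Θ (ThetaHat rstar ω) (ThetaHat (rhat ω) ω)
  have m := hk_mono hle
  linarith
end

section
/- Let δ ∈ (0,1] and let r*_δ ∈ ℛ satisfy ℙ(𝒯_{r*_δ}) ≥ 1 − δ. Then there exists a measurable event A with ℙ(A) ≥ 1 − δ such that for every ω ∈ A one has r̂(ω) ≤ r*_δ and max_{i ≠ j} |Θ_{ij} − (Θ̂_{r̂(ω)}(ω))_{ij}| ≤ 3·C·r*_δ. (Theorem 2 of the main paper: finite-sample bound for the adaptive validation calibration of matrix-valued estimators such as the graphical lasso, with the ℓ∞-loss on the off-diagonals and linear bound k(r) = C·r.) -/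
open MeasureTheory Matrix

/-- The ℓ∞-distance on the off-diagonal entries: `max_{i ≠ j} |A_{ij} − B_{ij}|`. -/
noncomputable def offDist {d : ℕ} (A B : Matrix (Fin d) (Fin d) ℝ) : ℝ :=
  ⨆ p : {p : Fin d × Fin d // p.1 ≠ p.2}, |A p.val.1 p.val.2 - B p.val.1 p.val.2|

theorem offDist_nonneg_aux {d : ℕ} (A B : Matrix (Fin d) (Fin d) ℝ) : 0 ≤ offDist A B :=
  Real.iSup_nonneg fun _ => abs_nonneg _

theorem offDist_symm_aux {d : ℕ} (A B : Matrix (Fin d) (Fin d) ℝ) : offDist A B = offDist B A := by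
  unfold offDist
  simp only [abs_sub_comm]

theorem le_offDist_aux {d : ℕ} (A B : Matrix (Fin d) (Fin d) ℝ)
    (p : {p : Fin d × Fin d // p.1 ≠ p.2}) :
    |A p.val.1 p.val.2 - B p.val.1 p.val.2| ≤ offDist A B :=
  le_ciSup (f := fun p : {p : Fin d × Fin d // p.1 ≠ p.2} =>
    |A p.val.1 p.val.2 - B p.val.1 p.val.2|) (Set.finite_range _).bddAbove p

theorem offDist_triangle_aux {d : ℕ} (A B D : Matrix (Fin d) (Fin d) ℝ) :
    offDist A D ≤ offDist A B + offDist B D :=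
  Real.iSup_le (fun p => (abs_sub_le _ (B p.val.1 p.val.2) _).trans
    (add_le_add (le_offDist_aux A B p) (le_offDist_aux B D p)))
    (add_nonneg (offDist_nonneg_aux _ _) (offDist_nonneg_aux _ _))

/-- Theorem 2 of the main paper: finite-sample bound for the adaptive validation
calibration of matrix-valued estimators with the ℓ∞-loss on the off-diagonals and
linear bound `k(r) = C·r`. -/
theorem stmt_5 {d : ℕ} (hd : 2 ≤ d)
    (Theta : Matrix (Fin d) (Fin d) ℝ)
    (hTheta_symm : Theta.IsSymm) (hTheta_pd : Theta.PosDef)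
    (R : Finset ℝ) (hR : R.Nonempty)
    (C : ℝ) (hC : 0 < C)
    {Ω : Type*} [MeasurableSpace Ω]
    (P : Measure Ω) [IsProbabilityMeasure P]
    (ThetaHat : ℝ → Ω → Matrix (Fin d) (Fin d) ℝ)
    (hThat_symm : ∀ r ∈ R, ∀ ω : Ω, (ThetaHat r ω).IsSymm)
    (hThat_pd : ∀ r ∈ R, ∀ ω : Ω, (ThetaHat r ω).PosDef)
    (T : ℝ → Set Ω)
    (hT_meas : ∀ r ∈ R, MeasurableSet (T r))
    (hT_mono : ∀ r' ∈ R, ∀ r'' ∈ R, r' ≤ r'' → T r' ⊆ T r'')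
    (hT_bound : ∀ r ∈ R, ∀ ω ∈ T r, offDist Theta (ThetaHat r ω) ≤ C * r)
    (rhat : Ω → ℝ)
    (hrhat : ∀ ω : Ω, IsLeast
      {r ∈ (↑R : Set ℝ) | ∀ r' ∈ R, ∀ r'' ∈ R, r ≤ r' → r ≤ r'' →
        offDist (ThetaHat r' ω) (ThetaHat r'' ω) ≤ C * (r' + r'')} (rhat ω))
    (δ : ℝ) (hδ : δ ∈ Set.Ioc (0 : ℝ) 1)
    (rstar : ℝ) (hrstar : rstar ∈ R)
    (hP : 1 - ENNReal.ofReal δ ≤ P (T rstar)) :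
    ∃ A : Set Ω, MeasurableSet A ∧ 1 - ENNReal.ofReal δ ≤ P A ∧
      ∀ ω ∈ A, rhat ω ≤ rstar ∧
        offDist Theta (ThetaHat (rhat ω) ω) ≤ 3 * C * rstar := by
  refine ⟨T rstar, hT_meas _ hrstar, hP, fun ω hω => ?_⟩
  have key : ∀ r ∈ R, rstar ≤ r → offDist Theta (ThetaHat r ω) ≤ C * r := fun r hr hle =>
    hT_bound r hr ω (hT_mono _ hrstar _ hr hle hω)
  have hle : rhat ω ≤ rstar := by
    refine (hrhat ω).2 ⟨hrstar, fun r' hr' r'' hr'' h' h'' => ?_⟩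
    have h1 := offDist_triangle_aux (ThetaHat r' ω) Theta (ThetaHat r'' ω)
    rw [offDist_symm_aux (ThetaHat r' ω) Theta] at h1
    have h2 := key r' hr' h'
    have h3 := key r'' hr'' h''
    linarith
  refine ⟨hle, ?_⟩
  have hm := (hrhat ω).1
  have h1 := hm.2 rstar hrstar (rhat ω) hm.1 hle le_rfl
  have h2 := key rstar hrstar le_rfl
  have h3 := offDist_triangle_aux Theta (ThetaHat rstar ω) (ThetaHat (rhat ω) ω)
  have h4 := mul_le_mul_of_nonneg_left hle hC.le
  linarith
end

section
/- Let λ ∈ (0,3], δ ∈ (0,1], and let r*_δ ∈ ℛ satisfy ℙ(𝒯_{r*_δ}) ≥ 1 − δ. Then there exists a measurable event A with ℙ(A) ≥ 1 − δ such that for every ω ∈ A and every pair i ≠ j with Θ_{ij} = 0, one has |(Θ̂_{r̂(ω)}(ω))_{ij}| ∈ [0, 3·C·r*_δ], and consequently |(Θ̂_{r̂(ω)}(ω))_{ij}| > λ·C·r̂(ω) (i.e., the edge (i,j) is included in the estimated edge set of the thresholded estimator) if and only if |(Θ̂_{r̂(ω)}(ω))_{ij}| ∈ (λ·C·r̂(ω),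 3·C·r*_δ]. (Part 1 of the finite-sample graph recovery corollary for the thresholded adaptive validation estimator.) -/
open MeasureTheory Matrix

theorem abs_sub_le_offDist {d : ℕ} (A B : Matrix (Fin d) (Fin d) ℝ) (i j : Fin d)
    (h : i ≠ j) : |A i j - B i j| ≤ offDist A B :=
  le_ciSup (f := fun p : {p : Fin d × Fin d // p.1 ≠ p.2} =>
    |A p.val.1 p.val.2 - B p.val.1 p.val.2|) (Set.finite_range _).bddAbove ⟨(i, j), h⟩

/-- Part 1 of the finite-sample graph recovery corollary for the thresholded
adaptive validation estimator: with probability at least `1 − δ`, every true zero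
entry of the precision matrix is estimated with absolute value in `[0, 3·C·r*_δ]`,
and hence it is included in the estimated edge set (i.e. exceeds the threshold
`λ·C·r̂`) if and only if its absolute value lies in `(λ·C·r̂, 3·C·r*_δ]`. -/
theorem stmt_7 {d : ℕ} (hd : 2 ≤ d)
    (Theta : Matrix (Fin d) (Fin d) ℝ)
    (hTheta_symm : Theta.IsSymm) (hTheta_pd : Theta.PosDef)
    (R : Finset ℝ) (hR : R.Nonempty) (hRpos : ∀ r ∈ R, 0 < r)
    (C : ℝ) (hC : 0 < C)
    {Ω : Type*} [MeasurableSpace Ω]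
    (P : Measure Ω) [IsProbabilityMeasure P]
    (ThetaHat : ℝ → Ω → Matrix (Fin d) (Fin d) ℝ)
    (hThat_symm : ∀ r ∈ R, ∀ ω : Ω, (ThetaHat r ω).IsSymm)
    (hThat_pd : ∀ r ∈ R, ∀ ω : Ω, (ThetaHat r ω).PosDef)
    (T : ℝ → Set Ω)
    (hT_meas : ∀ r ∈ R, MeasurableSet (T r))
    (hT_mono : ∀ r' ∈ R, ∀ r'' ∈ R, r' ≤ r'' → T r' ⊆ T r'')
    (hT_bound : ∀ r ∈ R, ∀ ω ∈ T r, offDist Theta (ThetaHat r ω) ≤ C * r)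
    (rhat : Ω → ℝ)
    (hrhat : ∀ ω : Ω, IsLeast
      {r ∈ (↑R : Set ℝ) | ∀ r' ∈ R, ∀ r'' ∈ R, r ≤ r' → r ≤ r'' →
        offDist (ThetaHat r' ω) (ThetaHat r'' ω) ≤ C * (r' + r'')} (rhat ω))
    (lam : ℝ) (hlam : lam ∈ Set.Ioc (0 : ℝ) 3)
    (δ : ℝ) (hδ : δ ∈ Set.Ioc (0 : ℝ) 1)
    (rstar : ℝ) (hrstar : rstar ∈ R)
    (hP : 1 - ENNReal.ofReal δ ≤ P (T rstar)) :
    ∃ A : Set Ω, MeasurableSet A ∧ 1 - ENNReal.ofReal δ ≤ P A ∧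
      ∀ ω ∈ A, ∀ i j : Fin d, i ≠ j → Theta i j = 0 →
        |ThetaHat (rhat ω) ω i j| ∈ Set.Icc 0 (3 * C * rstar) ∧
        (lam * C * rhat ω < |ThetaHat (rhat ω) ω i j| ↔
          |ThetaHat (rhat ω) ω i j| ∈ Set.Ioc (lam * C * rhat ω) (3 * C * rstar)) := by
  refine ⟨T rstar, hT_meas _ hrstar, hP, ?_⟩
  intro ω hω i j hij h0
  have hle : rhat ω ≤ rstar := by
    apply (hrhat ω).2
    refine ⟨hrstar, ?_⟩
    intro r' hr' r'' hr'' h1 h2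
    have b1 := hT_bound r' hr' ω (hT_mono _ hrstar _ hr' h1 hω)
    have b2 := hT_bound r'' hr'' ω (hT_mono _ hrstar _ hr'' h2 hω)
    have p1 := hRpos _ hr'
    have p2 := hRpos _ hr''
    refine Real.iSup_le ?_ (by positivity)
    rintro ⟨⟨a, b⟩, hab⟩
    have c1 := (abs_sub_le_offDist _ _ a b hab).trans b1
    have c2 := (abs_sub_le_offDist _ _ a b hab).trans b2
    rw [abs_le] at c1 c2 ⊢
    constructor <;> simp only <;> linarith [c1.1, c1.2, c2.1, c2.2]
  have hb := hT_bound rstar hrstar ω hω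
  have hd2 := (hrhat ω).1.2 (rhat ω) (hrhat ω).1.1 rstar hrstar le_rfl hle
  have c1 := (abs_sub_le_offDist _ _ i j hij).trans hb
  have c2 := (abs_sub_le_offDist _ _ i j hij).trans hd2
  have hm : C * rhat ω ≤ C * rstar := mul_le_mul_of_nonneg_left hle hC.le
  have key : |ThetaHat (rhat ω) ω i j| ≤ 3 * C * rstar := by
    rw [h0] at c1
    rw [abs_le] at c1 c2 ⊢
    constructor <;> linarith [c1.1, c1.2, c2.1, c2.2]
  exact ⟨⟨abs_nonneg _, key⟩, fun h => ⟨h, key⟩, fun h => h.1⟩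
end

section
/- Let α ∈ (0,1] and r > 0, assume the incoherence condition max_{e ∈ S^∁} ‖Γ_{eS}(Γ_{SS})^{-1}‖_1 ≤ 1 − α, and suppose max{ ℓ∞(Σ, Σ̂), ‖R_r‖_∞ } ≤ α·r/8, where R_r := Θ̃_r^{-1} − Θ^{-1} + Θ^{-1}·(Θ̃_r − Θ)·Θ^{-1} is the remainder of the first-order Taylor approximation of Θ̃_r^{-1} at Θ. Then the primal-dual witness construction succeeds: Θ̃_r = Θ̂_r, i.e., the support-constrained solution coincides with the (unconstrained) graphical lasso solution. (Lemmas 3 and 4 of Ravikumar et al., as stated and used in the supplement.) -/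
open Matrix
open scoped Classical

noncomputable section GlassoDefs

/-- Off-diagonal ℓ1-norm `‖Ω‖_{1,off} = Σ_{i ≠ j} |Ω_{ij}|`. -/
def offNorm1 {d : ℕ} (X : Matrix (Fin d) (Fin d) ℝ) : ℝ :=
  ∑ i, ∑ j, if i = j then 0 else |X i j|

/-- The graphical lasso objective `Ω ↦ tr(Σ̂·Ω) − log det Ω + r·‖Ω‖_{1,off}`. -/
def glassoObj {d : ℕ} (Sighat : Matrix (Fin d) (Fin d) ℝ) (r : ℝ)
    (X : Matrix (Fin d) (Fin d) ℝ) : ℝ :=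
  (Sighat * X).trace - Real.log X.det + r * offNorm1 X

/-- `X` is a graphical lasso estimator: a symmetric positive definite minimizer of
the graphical lasso objective over symmetric positive definite matrices. -/
def IsGlassoSol {d : ℕ} (Sighat : Matrix (Fin d) (Fin d) ℝ) (r : ℝ)
    (X : Matrix (Fin d) (Fin d) ℝ) : Prop :=
  X.IsSymm ∧ X.PosDef ∧
    ∀ Y : Matrix (Fin d) (Fin d) ℝ, Y.IsSymm → Y.PosDef →
      glassoObj Sighat r X ≤ glassoObj Sighat r Y

/-- `X` is a primal (support-constrained graphical lasso) solution: a symmetric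
positive definite minimizer of the objective over matrices vanishing off `S`. -/
def IsPrimalSol {d : ℕ} (Sighat : Matrix (Fin d) (Fin d) ℝ)
    (S : Set (Fin d × Fin d)) (r : ℝ) (X : Matrix (Fin d) (Fin d) ℝ) : Prop :=
  X.IsSymm ∧ X.PosDef ∧ (∀ p ∉ S, X p.1 p.2 = 0) ∧
    ∀ Y : Matrix (Fin d) (Fin d) ℝ, Y.IsSymm → Y.PosDef →
      (∀ p ∉ S, Y p.1 p.2 = 0) →
      glassoObj Sighat r X ≤ glassoObj Sighat r Y

/-- Support of the precision matrix (contains the diagonal). -/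
def supp {d : ℕ} (Th : Matrix (Fin d) (Fin d) ℝ) : Set (Fin d × Fin d) :=
  {p | Th p.1 p.2 ≠ 0}

/-- `κ_Σ`, the ℓ∞-operator norm `max_i Σ_j |Σ_{ij}|`. -/
def kappaSigma {d : ℕ} (Sig : Matrix (Fin d) (Fin d) ℝ) : ℝ :=
  ⨆ i, ∑ j, |Sig i j|

/-- `deg(Θ)`, the maximum degree `max_i #{j : Θ_{ij} ≠ 0}`. -/
def degTheta {d : ℕ} (Th : Matrix (Fin d) (Fin d) ℝ) : ℕ :=
  ⨆ i, {j | Th i j ≠ 0}.ncard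

/-- `ℓ∞(A,B) = max_{i,j} |A_{ij} − B_{ij}|`. -/
def linfDist {d : ℕ} (A B : Matrix (Fin d) (Fin d) ℝ) : ℝ :=
  ⨆ p : Fin d × Fin d, |A p.1 p.2 - B p.1 p.2|

/-- `‖A‖_∞ = max_{i,j} |A_{ij}|`. -/
def supNorm {d : ℕ} (A : Matrix (Fin d) (Fin d) ℝ) : ℝ :=
  ⨆ p : Fin d × Fin d, |A p.1 p.2|

/-- `Γ`, the Hessian of `Ω ↦ log det Ω` at `Θ`: `Γ_{(j,k),(l,m)} = Σ_{jl}·Σ_{km}`. -/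
def bigGamma {d : ℕ} (Sig : Matrix (Fin d) (Fin d) ℝ) :
    Matrix (Fin d × Fin d) (Fin d × Fin d) ℝ :=
  Matrix.of fun p q => Sig p.1 q.1 * Sig p.2 q.2

/-- `Γ_{SS}`, the submatrix of `Γ` with rows and columns indexed by `S`. -/
def gammaSS {d : ℕ} (Sig : Matrix (Fin d) (Fin d) ℝ) (S : Set (Fin d × Fin d)) :
    Matrix S S ℝ :=
  Matrix.of fun p q => bigGamma Sig p q

/-- `κ_Γ`, the ℓ∞-operator norm of `(Γ_{SS})⁻¹`. -/
def kappaGamma {d : ℕ} (Sig : Matrix (Fin d) (Fin d) ℝ) (S : Set (Fin d × Fin d)) : ℝ :=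
  ⨆ p : S, ∑ q : S, |(gammaSS Sig S)⁻¹ p q|

/-- `‖Γ_{eS}(Γ_{SS})⁻¹‖₁` for `e ∈ S^∁` (the incoherence quantity). -/
def incohVal {d : ℕ} (Sig : Matrix (Fin d) (Fin d) ℝ) (S : Set (Fin d × Fin d))
    (e : Fin d × Fin d) : ℝ :=
  ∑ q : S, |Matrix.vecMul (fun p : S => bigGamma Sig e p) (gammaSS Sig S)⁻¹ q|

end GlassoDefs

theorem eq_one_of_eigs {d : ℕ} {A : Matrix (Fin d) (Fin d) ℝ} (hA : A.IsHermitian)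
    (h : ∀ i, hA.eigenvalues i = 1) : A = 1 := by
  have h1 : diagonal (RCLike.ofReal ∘ hA.eigenvalues) = (1 : Matrix (Fin d) (Fin d) ℝ) := by
    rw [← diagonal_one]
    congr 1
    funext i
    simp [h]
  rw [hA.spectral_theorem, h1, map_one]

theorem log_det_lt {d : ℕ} {A : Matrix (Fin d) (Fin d) ℝ} (hA : A.PosDef) (hne : A ≠ 1) :
    Real.log A.det < A.trace - d := by
  have h0 := hA.eigenvalues_pos
  have hd : A.det = ∏ i, hA.1.eigenvalues i := by simpa using hA.1.det_eq_prod_eigenvalues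
  have ht : A.trace = ∑ i, hA.1.eigenvalues i := by simpa using hA.1.trace_eq_sum_eigenvalues
  rw [hd, ht, Real.log_prod (fun i _ => (h0 i).ne')]
  have : (∑ i, hA.1.eigenvalues i) - d = ∑ i, (hA.1.eigenvalues i - 1) := by
    simp
  rw [this]
  obtain ⟨i, hi⟩ : ∃ i, hA.1.eigenvalues i ≠ 1 := by
    by_contra! hc
    exact hne (eq_one_of_eigs hA.1 hc)
  exact Finset.sum_lt_sum (fun j _ => Real.log_le_sub_one_of_pos (h0 j))
    ⟨i, Finset.mem_univ _, Real.log_lt_sub_one_of_pos (h0 i) hi⟩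

open scoped MatrixOrder in
theorem exists_factor {d : ℕ} {T : Matrix (Fin d) (Fin d) ℝ} (hT : T.PosDef) :
    ∃ B : Matrix (Fin d) (Fin d) ℝ, T = Bᴴ * B ∧ IsUnit B.det := by
  obtain ⟨B, hB⟩ := CStarAlgebra.nonneg_iff_eq_star_mul_self.mp hT.posSemidef.nonneg
  refine ⟨B, hB, ?_⟩
  have h := hT.det_pos
  rw [hB, det_mul] at h
  exact isUnit_iff_ne_zero.mpr (fun h0 => by simp [h0] at h)

/-- strict concavity of log det -/
theorem log_det_strict {d : ℕ} {T Y : Matrix (Fin d) (Fin d) ℝ} (hT : T.PosDef) (hY : Y.PosDef)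
    (hne : Y ≠ T) : Real.log Y.det < Real.log T.det + (T⁻¹ * (Y - T)).trace := by
  obtain ⟨B, hB, hBu⟩ := exists_factor hT.inv
  have hBB : IsUnit B := (Matrix.isUnit_iff_isUnit_det B).mpr hBu
  have hTu : IsUnit T.det := (Matrix.isUnit_iff_isUnit_det T).mp hT.isUnit
  have hA : (B * Y * Bᴴ).PosDef := by
    refine hY.mul_mul_conjTranspose_same ?_
    exact Matrix.vecMul_injective_iff_isUnit.mpr hBB
  have hne' : B * Y * Bᴴ ≠ 1 := by
    intro h
    apply hne
    have h2 : Bᴴ * (B * Y * Bᴴ) = Bᴴ := by rw [h, mul_one]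
    have hBt : IsUnit Bᴴ.det := by simpa [det_conjTranspose] using hBu
    have h3 : T⁻¹ * Y * Bᴴ = Bᴴ := by rw [hB]; simpa only [Matrix.mul_assoc] using h2
    have h4 : T⁻¹ * Y = 1 := by
      have := congrArg (· * (Bᴴ)⁻¹) h3
      simpa only [Matrix.mul_assoc, Matrix.mul_nonsing_inv _ hBt, mul_one] using this
    have := congrArg (T * ·) h4
    simpa [← Matrix.mul_assoc, Matrix.mul_nonsing_inv _ hTu] using this
  have key := log_det_lt hA hne'
  have e1 : (B * Y * Bᴴ).trace = (T⁻¹ * Y).trace := by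
    rw [hB, Matrix.trace_mul_comm, Matrix.mul_assoc]
  have e2 : (B * Y * Bᴴ).det = T.det⁻¹ * Y.det := by
    have : T.det⁻¹ = (T⁻¹).det := by simp [Matrix.det_nonsing_inv]
    rw [this, hB]; simp only [det_mul]; ring
  have e3 : (T⁻¹ * (Y - T)).trace = (T⁻¹ * Y).trace - d := by
    rw [Matrix.mul_sub, Matrix.nonsing_inv_mul _ hTu]; simp
  rw [e1, e2, Real.log_mul (inv_ne_zero hT.det_pos.ne') hY.det_pos.ne', Real.log_inv] at key
  rw [e3]; linarith

theorem log_det_le {d : ℕ} {T Y : Matrix (Fin d) (Fin d) ℝ} (hT : T.PosDef) (hY : Y.PosDef) :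
    Real.log Y.det ≤ Real.log T.det + (T⁻¹ * (Y - T)).trace := by
  by_cases h : Y = T
  · subst h; simp
  · exact (log_det_strict hT hY h).le

open scoped MatrixOrder in
theorem posDef_lower {d : ℕ} {T : Matrix (Fin d) (Fin d) ℝ} (hT : T.PosDef) :
    ∃ c : ℝ, 0 < c ∧ ∀ x : Fin d → ℝ, c * (x ⬝ᵥ x) ≤ x ⬝ᵥ (T *ᵥ x) := by
  rcases isEmpty_or_nonempty (Fin d) with he | he
  · exact ⟨1, one_pos, fun x => by simp [dotProduct]⟩
  obtain ⟨i, hi⟩ := Finite.exists_min hT.1.eigenvalues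
  refine ⟨hT.1.eigenvalues i, hT.eigenvalues_pos i, fun x => ?_⟩
  have hle : algebraMap ℝ (Matrix (Fin d) (Fin d) ℝ) (hT.1.eigenvalues i) ≤ T := by
    rw [algebraMap_le_iff_le_spectrum (ha := hT.1)]
    intro y hy
    rw [hT.1.spectrum_real_eq_range_eigenvalues] at hy
    obtain ⟨j, rfl⟩ := hy
    exact hi j
  have := (Matrix.le_iff.mp hle).dotProduct_mulVec_nonneg x
  rw [Matrix.sub_mulVec, dotProduct_sub, Algebra.algebraMap_eq_smul_one, Matrix.smul_mulVec] at this
  simp at this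
  linarith

theorem posDef_perturb {d : ℕ} {T D : Matrix (Fin d) (Fin d) ℝ} (hT : T.PosDef) (hD : D.IsSymm) :
    ∃ δ : ℝ, 0 < δ ∧ ∀ t : ℝ, 0 ≤ t → t < δ → (T + t • D).PosDef := by
  obtain ⟨c, hc, hcT⟩ := posDef_lower hT
  set K : ℝ := ∑ i, ∑ j, |D i j| with hK
  have hK0 : 0 ≤ K := by positivity
  have hDx : ∀ x : Fin d → ℝ, -(K * (x ⬝ᵥ x)) ≤ x ⬝ᵥ (D *ᵥ x) := by
    intro x
    have hxx : ∀ i, x i * x i ≤ x ⬝ᵥ x := fun i =>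
      Finset.single_le_sum (f := fun i => x i * x i) (fun j _ => mul_self_nonneg _)
        (Finset.mem_univ i)
    have e : x ⬝ᵥ (D *ᵥ x) = ∑ i, ∑ j, x i * (D i j * x j) := by
      simp [dotProduct, Matrix.mulVec, Finset.mul_sum]
    rw [e, hK, Finset.sum_mul, ← Finset.sum_neg_distrib]
    refine Finset.sum_le_sum fun i _ => ?_
    rw [Finset.sum_mul, ← Finset.sum_neg_distrib]
    refine Finset.sum_le_sum fun j _ => ?_
    have h1 : |x i * x j| ≤ x ⬝ᵥ x := by
      rw [abs_le]; constructor <;> nlinarith [hxx i, hxx j, sq_nonneg (x i + x j), sq_nonneg (x i - x j)]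
    have h2 : |x i * (D i j * x j)| ≤ |D i j| * (x ⬝ᵥ x) := by
      rw [show x i * (D i j * x j) = D i j * (x i * x j) by ring, abs_mul]
      exact mul_le_mul_of_nonneg_left h1 (abs_nonneg _)
    exact (abs_le.mp h2).1
  refine ⟨c / (K + 1), by positivity, fun t ht0 ht => ?_⟩
  have htK : t * (K + 1) < c := by rwa [lt_div_iff₀ (by positivity)] at ht
  refine Matrix.PosDef.of_dotProduct_mulVec_pos ?_ ?_
  · refine hT.1.add ?_
    rw [Matrix.IsHermitian, conjTranspose_eq_transpose_of_trivial, transpose_smul, hD.eq]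
  · intro x hx
    have hpos : 0 < x ⬝ᵥ x := by
      simpa using (Matrix.dotProduct_star_self_pos_iff (v := x)).mpr hx
    rw [Matrix.add_mulVec, dotProduct_add, Matrix.smul_mulVec, dotProduct_smul]
    simp only [star_trivial, smul_eq_mul]
    nlinarith [hcT x, mul_le_mul_of_nonneg_left (hDx x) ht0]

theorem offNorm1_convex {d : ℕ} (T D : Matrix (Fin d) (Fin d) ℝ) (t : ℝ) (h0 : 0 ≤ t) (h1 : t ≤ 1) :
    offNorm1 (T + t • D) ≤ offNorm1 T + t * (offNorm1 (T + D) - offNorm1 T) := by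
  unfold offNorm1
  rw [← Finset.sum_sub_distrib, Finset.mul_sum, ← Finset.sum_add_distrib]
  refine Finset.sum_le_sum fun i _ => ?_
  rw [← Finset.sum_sub_distrib, Finset.mul_sum, ← Finset.sum_add_distrib]
  refine Finset.sum_le_sum fun j _ => ?_
  split_ifs
  · simp
  · simp only [Matrix.add_apply, Matrix.smul_apply, smul_eq_mul]
    have : T i j + t * D i j = (1 - t) * T i j + t * (T i j + D i j) := by ring
    rw [this]
    refine (abs_add_le _ _).trans ?_
    rw [abs_mul, abs_mul, abs_of_nonneg h0, abs_of_nonneg (sub_nonneg.mpr h1)]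
    linarith

theorem offNorm1_add_le {d : ℕ} (T D : Matrix (Fin d) (Fin d) ℝ) :
    offNorm1 (T + D) ≤ offNorm1 T + offNorm1 D := by
  unfold offNorm1
  rw [← Finset.sum_add_distrib]
  refine Finset.sum_le_sum fun i _ => ?_
  rw [← Finset.sum_add_distrib]
  refine Finset.sum_le_sum fun j _ => ?_
  split_ifs
  · simp
  · exact abs_add_le _ _

/-- First-order optimality of the primal solution. -/
theorem primal_first_order {d : ℕ} {Sighat T : Matrix (Fin d) (Fin d) ℝ}
    {S : Set (Fin d × Fin d)} {r : ℝ} (hr : 0 < r) (hT : IsPrimalSol Sighat S r T)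
    (D : Matrix (Fin d) (Fin d) ℝ) (hD : D.IsSymm) (hDS : ∀ p ∉ S, D p.1 p.2 = 0) :
    0 ≤ ((Sighat - T⁻¹) * D).trace + r * (offNorm1 (T + D) - offNorm1 T) := by
  obtain ⟨hTs, hTp, hTS, hmin⟩ := hT
  obtain ⟨δ, hδ, hPD⟩ := posDef_perturb hTp hD
  have hcont : Filter.Tendsto (fun t : ℝ => ((Sighat - (T + t • D)⁻¹) * D).trace
      + r * (offNorm1 (T + D) - offNorm1 T)) (nhdsWithin 0 (Set.Ioi 0))
      (nhds (((Sighat - T⁻¹) * D).trace + r * (offNorm1 (T + D) - offNorm1 T))) := by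
    have hl : Continuous (fun t : ℝ => T + t • D) := by fun_prop
    have hinv : ContinuousAt (fun t : ℝ => (T + t • D)⁻¹) 0 := by
      have : (fun t : ℝ => (T + t • D)⁻¹)
          = fun t : ℝ => ((T + t • D).det)⁻¹ • (T + t • D).adjugate := by
        funext t; rw [Matrix.inv_def, Ring.inverse_eq_inv']
      rw [this]
      refine ContinuousAt.smul (ContinuousAt.inv₀ hl.matrix_det.continuousAt ?_)
        hl.matrix_adjugate.continuousAt
      simpa using hTp.det_pos.ne'
    have h2 : ContinuousAt (fun t : ℝ => ((Sighat - (T + t • D)⁻¹) * D).trace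
        + r * (offNorm1 (T + D) - offNorm1 T)) 0 := by
      refine ContinuousAt.add ?_ continuousAt_const
      have hf : Continuous (fun M : Matrix (Fin d) (Fin d) ℝ => ((Sighat - M) * D).trace) := by
        refine Continuous.matrix_trace ?_
        exact (continuous_const.sub continuous_id).matrix_mul continuous_const
      exact ContinuousAt.comp (g := fun M : Matrix (Fin d) (Fin d) ℝ => ((Sighat - M) * D).trace)
        hf.continuousAt hinv
    have h3 := h2.tendsto
    simp only [zero_smul, add_zero] at h3
    exact h3.mono_left nhdsWithin_le_nhds
  refine ge_of_tendsto hcont ?_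
  have hmem : Set.Ioo (0 : ℝ) (min δ 1) ∈ nhdsWithin (0 : ℝ) (Set.Ioi 0) :=
    Ioo_mem_nhdsGT (lt_min hδ one_pos)
  filter_upwards [hmem] with t ht
  obtain ⟨ht0, ht1⟩ := ht
  have htδ := ht1.trans_le (min_le_left _ _)
  have ht1' := (ht1.trans_le (min_le_right _ _)).le
  have hY := hPD t ht0.le htδ
  have hopt := hmin (T + t • D) (by
      rw [Matrix.IsSymm, transpose_add, transpose_smul, hTs.eq, hD.eq]) hY
    (fun p hp => by simp [hTS p hp, hDS p hp])
  have hlog := log_det_le hY hTp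
  have hoff := offNorm1_convex T D t ht0.le ht1'
  have e1 : ((T + t • D)⁻¹ * (T - (T + t • D))).trace = - t * ((T + t • D)⁻¹ * D).trace := by
    have : T - (T + t • D) = (-t) • D := by simp
    rw [this, Matrix.mul_smul, trace_smul, smul_eq_mul]
  rw [e1] at hlog
  unfold glassoObj at hopt
  rw [Matrix.mul_add, trace_add, Matrix.mul_smul, trace_smul, smul_eq_mul] at hopt
  rw [Matrix.sub_mul, trace_sub]
  have hoff' := mul_le_mul_of_nonneg_left hoff hr.le
  refine nonneg_of_mul_nonneg_right (a := t) ?_ ht0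
  nlinarith


theorem offNorm1_single_le {d : ℕ} (i j : Fin d) (a : ℝ) :
    offNorm1 (Matrix.single i j a) ≤ |a| := by
  unfold offNorm1
  have : ∀ k l, (if k = l then 0 else |Matrix.single i j a k l|) ≤
      if k = i then (if l = j then |a| else 0) else 0 := by
    intro k l
    by_cases h : i = k ∧ j = l
    · obtain ⟨rfl, rfl⟩ := h
      simp only [Matrix.single_apply_same, if_true]
      split_ifs
      · exact abs_nonneg a
      · exact le_rfl
    · rw [Matrix.single_apply, if_neg h, abs_zero, ite_self]
      split_ifs
      · exact abs_nonneg a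
      · exact le_rfl
      · exact le_rfl
  calc _ ≤ ∑ k, ∑ l, (if k = i then (if l = j then |a| else 0) else 0) :=
        Finset.sum_le_sum fun k _ => Finset.sum_le_sum fun l _ => this k l
    _ = |a| := by
        rw [Finset.sum_eq_single i]
        · simp
        · intro b _ hb; simp [hb]
        · simp

theorem trace_mul_symm {d : ℕ} (G M : Matrix (Fin d) (Fin d) ℝ) (hM : M.IsSymm) :
    (G * M).trace = ∑ i, ∑ j, G i j * M i j := by
  simp only [Matrix.trace, Matrix.diag, Matrix.mul_apply]
  refine Finset.sum_congr rfl fun i _ => Finset.sum_congr rfl fun j _ => ?_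
  rw [hM.apply i j]

/-- The gradient of the smooth part is bounded by `r` on `S`. -/
theorem primal_grad_bound {d : ℕ} {Sighat T : Matrix (Fin d) (Fin d) ℝ}
    {S : Set (Fin d × Fin d)} {r : ℝ} (hr : 0 < r) (hT : IsPrimalSol Sighat S r T)
    (hG : (Sighat - T⁻¹).IsSymm) (hS : ∀ i j, (i, j) ∈ S → (j, i) ∈ S)
    (i j : Fin d) (hij : (i, j) ∈ S) : |(Sighat - T⁻¹) i j| ≤ r := by
  have key : ∀ a : ℝ, 0 ≤ 2 * (a * (Sighat - T⁻¹) i j) + r * (2 * |a|) := by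
    intro a
    have h := primal_first_order hr hT (Matrix.single i j a + Matrix.single j i a)
      (by rw [Matrix.IsSymm, transpose_add, Matrix.transpose_single, Matrix.transpose_single,
            add_comm])
      (by
        rintro ⟨k, l⟩ hp
        simp only [Matrix.add_apply, Matrix.single_apply]
        rw [if_neg, if_neg, add_zero]
        · rintro ⟨rfl, rfl⟩; exact hp (hS _ _ hij)
        · rintro ⟨rfl, rfl⟩; exact hp hij)
    have h1 := offNorm1_add_le T (Matrix.single i j a + Matrix.single j i a)
    have h2 := offNorm1_add_le (Matrix.single i j a) (Matrix.single j i a)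
    have h3 := offNorm1_single_le i j a
    have h4 := offNorm1_single_le j i a
    rw [Matrix.mul_add, trace_add, Matrix.trace_mul_single, Matrix.trace_mul_single,
      hG.apply i j] at h
    simp only [op_smul_eq_smul, smul_eq_mul] at h
    have h5 := mul_le_mul_of_nonneg_left (show offNorm1 (T + (Matrix.single i j a
      + Matrix.single j i a)) - offNorm1 T ≤ 2 * |a| by linarith) hr.le
    linarith
  have k1 := key 1
  have k2 := key (-1)
  rw [abs_neg] at k2
  rw [abs_one] at k1 k2
  rw [abs_le]; constructor <;> linarith

theorem gamma_apply {d : ℕ} (Sig Δ : Matrix (Fin d) (Fin d) ℝ) (hSig : Sig.IsSymm)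
    (S : Set (Fin d × Fin d)) (hΔ : ∀ p ∉ S, Δ p.1 p.2 = 0) (e : Fin d × Fin d) :
    (Sig * Δ * Sig) e.1 e.2 = ∑ q : S, bigGamma Sig e q * Δ q.1.1 q.1.2 := by
  have h1 : (Sig * Δ * Sig) e.1 e.2 = ∑ q : Fin d × Fin d, bigGamma Sig e q * Δ q.1 q.2 := by
    rw [Fintype.sum_prod_type, Finset.sum_comm]
    simp only [Matrix.mul_apply, bigGamma, Matrix.of_apply, Finset.sum_mul]
    refine Finset.sum_congr rfl fun i _ => Finset.sum_congr rfl fun j _ => ?_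
    rw [hSig.apply e.2 i]; ring
  rw [h1, ← Finset.sum_subset (Finset.subset_univ S.toFinset)
    (fun q _ hq => by rw [hΔ q (by simpa using hq), mul_zero])]
  exact Finset.sum_subtype S.toFinset (fun x => by simp) (fun q => bigGamma Sig e q * Δ q.1 q.2)

theorem incoh_bound {d : ℕ} (Sig Δ : Matrix (Fin d) (Fin d) ℝ) (hSig : Sig.IsSymm)
    (S : Set (Fin d × Fin d)) (hΔ : ∀ p ∉ S, Δ p.1 p.2 = 0)
    (hInv : IsUnit (gammaSS Sig S).det) (m : ℝ)
    (hm : ∀ p ∈ S, |(Sig * Δ * Sig) p.1 p.2| ≤ m) (e : Fin d × Fin d) :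
    |(Sig * Δ * Sig) e.1 e.2| ≤ incohVal Sig S e * m := by
  set v : S → ℝ := fun q => Δ q.1.1 q.1.2 with hv
  set w : S → ℝ := fun q => (Sig * Δ * Sig) q.1.1 q.1.2 with hw
  have h1 : gammaSS Sig S *ᵥ v = w := by
    funext q
    rw [hw]
    simp only
    rw [gamma_apply Sig Δ hSig S hΔ q.1]
    rfl
  have h2 : v = (gammaSS Sig S)⁻¹ *ᵥ w := by
    rw [← h1, Matrix.mulVec_mulVec, Matrix.nonsing_inv_mul _ hInv, Matrix.one_mulVec]
  have h3 : (Sig * Δ * Sig) e.1 e.2 =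
      Matrix.vecMul (fun p : S => bigGamma Sig e p) (gammaSS Sig S)⁻¹ ⬝ᵥ w := by
    rw [gamma_apply Sig Δ hSig S hΔ e, ← Matrix.dotProduct_mulVec, ← h2]
    rfl
  rw [h3, incohVal, Finset.sum_mul]
  refine (Finset.abs_sum_le_sum_abs _ _).trans (Finset.sum_le_sum fun q _ => ?_)
  rw [abs_mul]
  exact mul_le_mul_of_nonneg_left (hm q.1 q.2) (abs_nonneg _)

theorem witness_ineq {d : ℕ} {Sighat T : Matrix (Fin d) (Fin d) ℝ}
    {S : Set (Fin d × Fin d)} {r : ℝ} (hr : 0 < r) (hT : IsPrimalSol Sighat S r T)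
    (hS : ∀ i j, (i, j) ∈ S → (j, i) ∈ S) (hdiag : ∀ i, (i, i) ∈ S)
    (hb : ∀ p ∉ S, |(Sighat - T⁻¹) p.1 p.2| ≤ r)
    (Y : Matrix (Fin d) (Fin d) ℝ) (hY : Y.IsSymm) :
    0 ≤ ((Sighat - T⁻¹) * (Y - T)).trace + r * (offNorm1 Y - offNorm1 T) := by
  set X : Matrix (Fin d) (Fin d) ℝ := Matrix.of fun i j => if (i, j) ∈ S then Y i j else 0 with hX
  have hXs : X.IsSymm := by
    ext i j
    simp only [hX, Matrix.transpose_apply, Matrix.of_apply]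
    rw [hY.apply i j]
    have : (j, i) ∈ S ↔ (i, j) ∈ S := ⟨hS _ _, hS _ _⟩
    simp [this]
  have h1 := primal_first_order hr hT (X - T) (hXs.sub hT.1) (fun p hp => by
    have : X p.1 p.2 = 0 := by simp [hX, hp]
    simp [this, hT.2.2.1 p hp])
  rw [add_sub_cancel] at h1
  have h2 : 0 ≤ ((Sighat - T⁻¹) * (Y - X)).trace + r * (offNorm1 Y - offNorm1 X) := by
    rw [trace_mul_symm _ _ (hY.sub hXs)]
    unfold offNorm1
    rw [← Finset.sum_sub_distrib, Finset.mul_sum, ← Finset.sum_add_distrib]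
    refine Finset.sum_nonneg fun i _ => ?_
    rw [← Finset.sum_sub_distrib, Finset.mul_sum, ← Finset.sum_add_distrib]
    refine Finset.sum_nonneg fun j _ => ?_
    by_cases hij : (i, j) ∈ S
    · have : X i j = Y i j := by simp [hX, hij]
      rw [Matrix.sub_apply Y, this]; simp
    · have h0 : X i j = 0 := by simp [hX, hij]
      have hne : i ≠ j := by rintro rfl; exact hij (hdiag i)
      rw [Matrix.sub_apply Y, h0, if_neg hne, if_neg hne]
      simp only [sub_zero, abs_zero]
      have h4 : |(Sighat - T⁻¹) i j * Y i j| ≤ r * |Y i j| := by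
        rw [abs_mul]; exact mul_le_mul_of_nonneg_right (hb (i, j) hij) (abs_nonneg _)
      linarith [(abs_le.mp h4).1]
  have h3 : ((Sighat - T⁻¹) * (Y - T)).trace =
      ((Sighat - T⁻¹) * (Y - X)).trace + ((Sighat - T⁻¹) * (X - T)).trace := by
    rw [← trace_add, ← Matrix.mul_add, sub_add_sub_cancel]
  rw [h3]
  nlinarith

/-- Lemmas 3 and 4 of Ravikumar et al., as used in the supplement: under the
incoherence condition, if `max{ℓ∞(Σ,Σ̂), ‖R_r‖_∞} ≤ α·r/8` where `R_r` is the
remainder of the first-order Taylor approximation of `Θ̃_r⁻¹` at `Θ`, then the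
primal-dual witness construction succeeds: `Θ̃_r = Θ̂_r`. -/
theorem stmt_14 {d : ℕ} (hd : 2 ≤ d)
    (Sig : Matrix (Fin d) (Fin d) ℝ) (hSig_symm : Sig.IsSymm) (hSig_pd : Sig.PosDef)
    (Sighat : Matrix (Fin d) (Fin d) ℝ) (hSighat_symm : Sighat.IsSymm)
    (α r : ℝ) (hα : α ∈ Set.Ioc (0 : ℝ) 1) (hr : 0 < r)
    (ThetaHat ThetaTilde : Matrix (Fin d) (Fin d) ℝ)
    (hHat : IsGlassoSol Sighat r ThetaHat)
    (hTilde : IsPrimalSol Sighat (supp Sig⁻¹) r ThetaTilde)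
    (hInv : IsUnit (gammaSS Sig (supp Sig⁻¹)).det)
    (hIncoh : ∀ e ∈ (supp Sig⁻¹)ᶜ, incohVal Sig (supp Sig⁻¹) e ≤ 1 - α)
    (hEvent : max (linfDist Sig Sighat)
        (supNorm (ThetaTilde⁻¹ - (Sig⁻¹)⁻¹ +
          (Sig⁻¹)⁻¹ * (ThetaTilde - Sig⁻¹) * (Sig⁻¹)⁻¹)) ≤ α * r / 8) :
    ThetaTilde = ThetaHat := by
  have hSu : IsUnit Sig.det := (Matrix.isUnit_iff_isUnit_det Sig).mp hSig_pd.isUnit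
  rw [Matrix.nonsing_inv_nonsing_inv _ hSu] at hEvent
  have hT := hTilde
  obtain ⟨hTs, hTp, hTS, -⟩ := hTilde
  have hThs : (Sig⁻¹).IsSymm := by
    rw [Matrix.IsSymm, Matrix.transpose_nonsing_inv, hSig_symm.eq]
  have hTis : (ThetaTilde⁻¹).IsSymm := by
    rw [Matrix.IsSymm, Matrix.transpose_nonsing_inv, hTs.eq]
  have hG : (Sighat - ThetaTilde⁻¹).IsSymm := hSighat_symm.sub hTis
  have hS : ∀ i j, (i, j) ∈ supp Sig⁻¹ → (j, i) ∈ supp Sig⁻¹ := by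
    intro i j h
    simp only [supp, Set.mem_ofPred_eq] at h ⊢
    rwa [hThs.apply i j]
  have hdiag : ∀ i, (i, i) ∈ supp Sig⁻¹ := fun i => (hSig_pd.inv.diag_pos (i := i)).ne'
  set Δ := ThetaTilde - Sig⁻¹ with hΔ
  set R := ThetaTilde⁻¹ - Sig + Sig * Δ * Sig with hR
  have hE1 : ∀ p : Fin d × Fin d, |Sig p.1 p.2 - Sighat p.1 p.2| ≤ α * r / 8 := fun p =>
    (le_ciSup (f := fun p : Fin d × Fin d => |Sig p.1 p.2 - Sighat p.1 p.2|)
      (Set.finite_range _).bddAbove p).trans ((le_max_left _ _).trans hEvent)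
  have hE2 : ∀ p : Fin d × Fin d, |R p.1 p.2| ≤ α * r / 8 := fun p =>
    (le_ciSup (f := fun p : Fin d × Fin d => |R p.1 p.2|)
      (Set.finite_range _).bddAbove p).trans ((le_max_right _ _).trans hEvent)
  have hΔS : ∀ p ∉ supp Sig⁻¹, Δ p.1 p.2 = 0 := by
    intro p hp
    have h0 : Sig⁻¹ p.1 p.2 = 0 := by simpa [supp] using hp
    rw [hΔ, Matrix.sub_apply, hTS p hp, h0, sub_zero]
  have hM : ∀ p : Fin d × Fin d, (Sig * Δ * Sig) p.1 p.2 =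
      (Sighat - ThetaTilde⁻¹) p.1 p.2 + (Sig p.1 p.2 - Sighat p.1 p.2) + R p.1 p.2 := by
    intro p
    simp only [hR, Matrix.add_apply, Matrix.sub_apply]
    ring
  have hMS : ∀ p ∈ supp Sig⁻¹, |(Sig * Δ * Sig) p.1 p.2| ≤ r + α * r / 4 := by
    intro p hp
    have h1 := abs_le.mp (primal_grad_bound hr hT hG hS p.1 p.2 hp)
    have h2 := abs_le.mp (hE1 p)
    have h3 := abs_le.mp (hE2 p)
    rw [hM p, abs_le]
    constructor <;> linarith [h1.1, h1.2, h2.1, h2.2, h3.1, h3.2]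
  obtain ⟨hα0, hα1⟩ := hα
  have har : 0 < α * r := mul_pos hα0 hr
  have hb : ∀ p ∉ supp Sig⁻¹, |(Sighat - ThetaTilde⁻¹) p.1 p.2| ≤ r := by
    intro p hp
    have h1 := incoh_bound Sig Δ hSig_symm (supp Sig⁻¹) hΔS hInv _ hMS p
    have h1' := h1.trans (mul_le_mul_of_nonneg_right (hIncoh p hp)
      (show 0 ≤ r + α * r / 4 by linarith))
    have h4 : (1 - α) * (r + α * r / 4) ≤ r - α * r / 4 := by nlinarith
    have h1'' := abs_le.mp (h1'.trans h4)
    have h2 := abs_le.mp (hE1 p)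
    have h3 := abs_le.mp (hE2 p)
    have h5 := hM p
    rw [abs_le]
    constructor <;> linarith [h1''.1, h1''.2, h2.1, h2.2, h3.1, h3.2]
  obtain ⟨hHs, hHp, hHmin⟩ := hHat
  by_contra hne
  have hw := witness_ineq hr hT hS hdiag hb ThetaHat hHs
  have hlog := log_det_strict hTp hHp (fun h => hne h.symm)
  have hmin := hHmin ThetaTilde hTs hTp
  unfold glassoObj at hmin
  rw [Matrix.sub_mul, trace_sub, Matrix.mul_sub Sighat, trace_sub] at hw
  linarith
end

section
/- Let r > 0 and suppose ℓ∞(Θ, Θ̃_r) ≤ (3·κ_Σ·deg(Θ))^{-1}. Then the remainder R_r := Θ̃_r^{-1} − Θ^{-1} + Θ^{-1}·(Θ̃_r − Θ)·Θ^{-1} of the first-order Taylor approximation of Θ̃_r^{-1} at Θ satisfies ‖R_r‖_∞ ≤ κ_Σ/(6·deg(Θ)). (Lemma 5 of Ravikumar et al., as stated and used in the supplement.) -/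
open Matrix
open scoped Classical

/-- Row sums of absolute values bounded by `c`. -/
def RS {d : ℕ} (A : Matrix (Fin d) (Fin d) ℝ) (c : ℝ) : Prop := ∀ i, ∑ j, |A i j| ≤ c

lemma RS_kappa {d : ℕ} (A : Matrix (Fin d) (Fin d) ℝ) : RS A (kappaSigma A) := fun i =>
  le_ciSup (f := fun i => ∑ j, |A i j|) (Set.finite_range _).bddAbove i

lemma mul_entry_le {d : ℕ} (A B : Matrix (Fin d) (Fin d) ℝ) (i j : Fin d) :
    |(A * B) i j| ≤ ∑ k, |A i k| * |B k j| := by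
  rw [Matrix.mul_apply]
  refine (Finset.abs_sum_le_sum_abs _ _).trans (le_of_eq ?_)
  simp only [abs_mul]

lemma RS.mul {d : ℕ} {A B : Matrix (Fin d) (Fin d) ℝ} {a b : ℝ} (hb : 0 ≤ b)
    (hA : RS A a) (hB : RS B b) : RS (A * B) (a * b) := by
  intro i
  calc ∑ j, |(A * B) i j| ≤ ∑ j, ∑ k, |A i k| * |B k j| :=
        Finset.sum_le_sum fun j _ => mul_entry_le A B i j
    _ = ∑ k, |A i k| * ∑ j, |B k j| := by
        rw [Finset.sum_comm]; simp only [Finset.mul_sum]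
    _ ≤ ∑ k, |A i k| * b :=
        Finset.sum_le_sum fun k _ => mul_le_mul_of_nonneg_left (hB k) (abs_nonneg _)
    _ = (∑ k, |A i k|) * b := by rw [Finset.sum_mul]
    _ ≤ a * b := mul_le_mul_of_nonneg_right (hA i) hb

lemma RS.sub {d : ℕ} {A B : Matrix (Fin d) (Fin d) ℝ} {a b : ℝ}
    (hA : RS A a) (hB : RS B b) : RS (A - B) (a + b) := by
  intro i
  calc ∑ j, |(A - B) i j| ≤ ∑ j, (|A i j| + |B i j|) :=
        Finset.sum_le_sum fun j _ => by rw [Matrix.sub_apply]; exact abs_sub _ _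
    _ = ∑ j, |A i j| + ∑ j, |B i j| := Finset.sum_add_distrib
    _ ≤ a + b := add_le_add (hA i) (hB i)

/-- Lemma 5 of Ravikumar et al., as used in the supplement: if
`ℓ∞(Θ, Θ̃_r) ≤ (3 κ_Σ deg Θ)⁻¹`, then the remainder
`R_r = Θ̃_r⁻¹ − Θ⁻¹ + Θ⁻¹(Θ̃_r − Θ)Θ⁻¹` of the first-order Taylor approximation
of `Θ̃_r⁻¹` at `Θ` satisfies `‖R_r‖_∞ ≤ κ_Σ/(6 deg Θ)`. -/
theorem stmt_15 {d : ℕ} (hd : 2 ≤ d)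
    (Sig : Matrix (Fin d) (Fin d) ℝ) (hSig_symm : Sig.IsSymm) (hSig_pd : Sig.PosDef)
    (Sighat : Matrix (Fin d) (Fin d) ℝ) (hSighat_symm : Sighat.IsSymm)
    (r : ℝ) (hr : 0 < r)
    (ThetaTilde : Matrix (Fin d) (Fin d) ℝ)
    (hTilde : IsPrimalSol Sighat (supp Sig⁻¹) r ThetaTilde)
    (hTildeBound : linfDist Sig⁻¹ ThetaTilde ≤
      (3 * kappaSigma Sig * (degTheta Sig⁻¹ : ℝ))⁻¹) :
    supNorm (ThetaTilde⁻¹ - (Sig⁻¹)⁻¹ +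
        (Sig⁻¹)⁻¹ * (ThetaTilde - Sig⁻¹) * (Sig⁻¹)⁻¹) ≤
      kappaSigma Sig / (6 * (degTheta Sig⁻¹ : ℝ)) := by
  have hne : Nonempty (Fin d) := ⟨⟨0, by omega⟩⟩
  obtain ⟨hTs, hTpd, hTsupp, -⟩ := hTilde
  have hinv : (Sig⁻¹)⁻¹ = Sig := Matrix.nonsing_inv_nonsing_inv _ hSig_pd.det_pos.ne'.isUnit
  have hThpd : (Sig⁻¹).PosDef := hSig_pd.inv
  rw [hinv]
  set T := ThetaTilde with hT
  set Th := Sig⁻¹ with hTh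
  set κ := kappaSigma Sig with hκ
  set D := T - Th with hD
  set δ := linfDist Th T with hδ
  have hST : Sig * Th = 1 := Matrix.mul_nonsing_inv _ hSig_pd.det_pos.ne'.isUnit
  have hTT : T * T⁻¹ = 1 := Matrix.mul_nonsing_inv _ hTpd.det_pos.ne'.isUnit
  have hκS : RS Sig κ := RS_kappa Sig
  have hκ0 : 0 < κ := by
    obtain ⟨i⟩ := hne
    have h1 : 0 < Sig i i := hSig_pd.diag_pos
    have h2 := Finset.single_le_sum (f := fun j => |Sig i j|) (fun j _ => abs_nonneg _)
      (Finset.mem_univ i)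
    have h3 := hκS i
    have h4 := le_abs_self (Sig i i)
    linarith
  have hdeg : ∀ i, {j | Th i j ≠ 0}.ncard ≤ degTheta Th := fun i =>
    le_ciSup (f := fun i => {j | Th i j ≠ 0}.ncard) (Set.finite_range _).bddAbove i
  have hdeg0 : 0 < degTheta Th := by
    obtain ⟨i⟩ := hne
    refine lt_of_lt_of_le ?_ (hdeg i)
    rw [Set.ncard_pos]
    exact ⟨i, hThpd.diag_pos.ne'⟩
  set n : ℝ := (degTheta Th : ℝ) with hn
  have hn0 : 0 < n := by rw [hn]; exact_mod_cast hdeg0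
  have hDent : ∀ i j, |D i j| ≤ δ := fun i j => by
    have := le_ciSup (f := fun p : Fin d × Fin d => |Th p.1 p.2 - T p.1 p.2|)
      (Set.finite_range _).bddAbove (i, j)
    rw [hD, Matrix.sub_apply, abs_sub_comm]
    exact this
  have hδ0 : 0 ≤ δ := (abs_nonneg _).trans (hDent hne.some hne.some)
  have hDz : ∀ i j, Th i j = 0 → D i j = 0 := fun i j h => by
    have h2 := hTsupp (i, j) (by simp [supp, h])
    simp only at h2
    rw [hD, Matrix.sub_apply, h, h2, sub_zero]
  have hDRS : RS D (n * δ) := by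
    intro i
    calc ∑ j, |D i j| ≤ ∑ j, (if Th i j ≠ 0 then δ else 0) := by
          refine Finset.sum_le_sum fun j _ => ?_
          split_ifs with h
          · exact hDent i j
          · rw [hDz i j (not_not.mp h), abs_zero]
      _ = ({j | Th i j ≠ 0}.ncard : ℝ) * δ := by
          rw [← Finset.sum_filter, Finset.sum_const, nsmul_eq_mul, Set.ncard_eq_toFinset_card']
          simp
      _ ≤ n * δ := mul_le_mul_of_nonneg_right (by rw [hn]; exact_mod_cast hdeg i) hδ0
  have hprod : κ * n * δ ≤ 1 / 3 := by
    have h := mul_le_mul_of_nonneg_left hTildeBound (mul_pos hκ0 hn0).le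
    have h2 : κ * n * (3 * κ * n)⁻¹ = 1 / 3 := by field_simp
    linarith
  -- resolvent identity
  have hres : T⁻¹ = Sig - Sig * D * T⁻¹ := by
    rw [hD, mul_sub, sub_mul, hST, mul_assoc, hTT]; simp
  set t := kappaSigma T⁻¹ with ht
  have htRS : RS T⁻¹ t := RS_kappa _
  have ht0 : 0 ≤ t := (Finset.sum_nonneg fun _ _ => abs_nonneg _).trans (htRS hne.some)
  have htle : t ≤ 3 / 2 * κ := by
    have h1 : RS T⁻¹ (κ + κ * (n * δ) * t) := by
      rw [hres]
      exact hκS.sub ((hκS.mul (by positivity) hDRS).mul ht0 htRS)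
    have h2 : t ≤ κ + κ * (n * δ) * t := ciSup_le h1
    nlinarith
  have hR : T⁻¹ - Sig + Sig * D * Sig = (Sig * D) * (Sig * D * T⁻¹) := by
    have h : Sig * D * T⁻¹ = Sig - T⁻¹ := by nth_rewrite 2 [hres]; abel
    rw [h, mul_sub (Sig * D) Sig, h]; abel
  have hBT : RS (Sig * D * T⁻¹)ᵀ (t * (n * δ) * κ) := by
    have hDs : Dᵀ = D := by
      rw [hD, Matrix.transpose_sub, hTs.eq, hTh, Matrix.transpose_nonsing_inv, hSig_symm.eq]
    have : (Sig * D * T⁻¹)ᵀ = T⁻¹ * D * Sig := by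
      rw [Matrix.transpose_mul, Matrix.transpose_mul, hDs, hSig_symm.eq,
        Matrix.transpose_nonsing_inv, hTs.eq, mul_assoc]
    rw [this]
    exact (htRS.mul (by positivity) hDRS).mul hκ0.le hκS
  have hA : ∀ i j, |(Sig * D) i j| ≤ κ * δ := fun i j =>
    calc |(Sig * D) i j| ≤ ∑ k, |Sig i k| * |D k j| := mul_entry_le _ _ i j
      _ ≤ ∑ k, |Sig i k| * δ :=
          Finset.sum_le_sum fun k _ => mul_le_mul_of_nonneg_left (hDent k j) (abs_nonneg _)
      _ = (∑ k, |Sig i k|) * δ := by rw [Finset.sum_mul]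
      _ ≤ κ * δ := mul_le_mul_of_nonneg_right (hκS i) hδ0
  rw [hR]
  refine ciSup_le fun p => ?_
  calc |((Sig * D) * (Sig * D * T⁻¹)) p.1 p.2|
      ≤ ∑ k, |(Sig * D) p.1 k| * |(Sig * D * T⁻¹) k p.2| := mul_entry_le _ _ _ _
    _ ≤ ∑ k, κ * δ * |(Sig * D * T⁻¹) k p.2| :=
        Finset.sum_le_sum fun k _ => mul_le_mul_of_nonneg_right (hA _ _) (abs_nonneg _)
    _ = κ * δ * ∑ k, |(Sig * D * T⁻¹) k p.2| := by rw [Finset.mul_sum]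
    _ ≤ κ * δ * (t * (n * δ) * κ) :=
        mul_le_mul_of_nonneg_left (hBT p.2) (by positivity)
    _ ≤ κ * δ * (3 / 2 * κ * (n * δ) * κ) := by gcongr
    _ = 3 / 2 * κ * (κ * n * δ) ^ 2 / n := by field_simp
    _ ≤ 3 / 2 * κ * (1 / 3) ^ 2 / n := by gcongr
    _ = κ / (6 * n) := by field_simp; norm_num
end

section
/- Let α ∈ (0,1] and r > 0, and assume: (i) the incoherence condition max_{e ∈ S^∁} ‖Γ_{eS}(Γ_{SS})^{-1}‖_1 ≤ 1 − α; (ii) ℓ∞(Θ, Θ̃_r) ≤ (3·κ_Σ·deg(Θ))^{-1}; and (iii) max{ ℓ∞(Σ, Σ̂), κ_Σ/(6·deg(Θ)) } ≤ α·r/8. Then Θ̃_r = Θ̂_r, i.e., the support-constrained solution coincides with the (unconstrained) graphical lasso solution. (Intermediate step in the proof of the ℓ∞-bound for the graphical lasso: on the event 𝒯_r the primal-dual witness construction succeeds.) -/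
open Matrix
open scoped Classical

theorem gl_eq_one {d : ℕ} {M : Matrix (Fin d) (Fin d) ℝ} (hM : M.PosDef) :
    Real.log M.det ≤ M.trace - d ∧ (M.trace - d ≤ Real.log M.det → M = 1) := by
  have hdet := hM.1.det_eq_prod_eigenvalues
  have htr := hM.1.trace_eq_sum_eigenvalues
  simp only [RCLike.ofReal_real_eq_id, id] at hdet htr
  have hpos := hM.eigenvalues_pos
  have hl : Real.log M.det = ∑ i, Real.log (hM.1.eigenvalues i) := by
    rw [hdet, Real.log_prod]
    intro i _; exact (hpos i).ne'
  have hd : M.trace - d = ∑ i, (hM.1.eigenvalues i - 1) := by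
    rw [htr]; simp
  have hle : ∀ i ∈ Finset.univ, Real.log (hM.1.eigenvalues i) ≤ hM.1.eigenvalues i - 1 :=
    fun i _ => Real.log_le_sub_one_of_pos (hpos i)
  rw [hl, hd]
  refine ⟨Finset.sum_le_sum hle, fun h => ?_⟩
  have heq := (Finset.sum_eq_sum_iff_of_le hle).1 (le_antisymm (Finset.sum_le_sum hle) h)
  have h1 : hM.1.eigenvalues = 1 := by
    funext i
    by_contra hne
    exact (Real.log_lt_sub_one_of_pos (hpos i) hne).ne (heq i (Finset.mem_univ _))
  rw [hM.1.spectral_theorem, h1]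
  have : (RCLike.ofReal ∘ (1 : Fin d → ℝ) : Fin d → ℝ) = fun _ => 1 := by
    funext i; simp
  rw [this, Matrix.diagonal_one, map_one]

theorem gl_logdet {d : ℕ} {X Y : Matrix (Fin d) (Fin d) ℝ} (hX : X.PosDef) (hY : Y.PosDef) :
    Real.log Y.det - Real.log X.det ≤ (X⁻¹ * (Y - X)).trace ∧
    ((X⁻¹ * (Y - X)).trace ≤ Real.log Y.det - Real.log X.det → Y = X) := by
  obtain ⟨B, hB⟩ : ∃ B : Matrix (Fin d) (Fin d) ℝ, X = Bᴴ * B := by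
    open scoped MatrixOrder in
    exact CStarAlgebra.nonneg_iff_eq_star_mul_self.1 hX.posSemidef.nonneg
  have hXu : IsUnit X.det := (Matrix.isUnit_iff_isUnit_det _).1 hX.isUnit
  have hBu : IsUnit B.det := by
    rw [hB, Matrix.det_mul] at hXu
    exact isUnit_of_mul_isUnit_right hXu
  have hBHu : IsUnit Bᴴ.det := by
    rw [hB, Matrix.det_mul] at hXu
    exact isUnit_of_mul_isUnit_left hXu
  have hCu : IsUnit (B⁻¹) := (Matrix.isUnit_nonsing_inv_iff).2 ((Matrix.isUnit_iff_isUnit_det _).2 hBu)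
  have hM : ((B⁻¹)ᴴ * Y * B⁻¹).PosDef :=
    (Matrix.IsUnit.posDef_star_left_conjugate_iff hCu).2 hY
  have hXi : X⁻¹ = B⁻¹ * (B⁻¹)ᴴ := by
    rw [hB, Matrix.mul_inv_rev, Matrix.conjTranspose_nonsing_inv]
  have htr : (X⁻¹ * (Y - X)).trace = ((B⁻¹)ᴴ * Y * B⁻¹).trace - d := by
    rw [Matrix.mul_sub, Matrix.nonsing_inv_mul _ hXu, Matrix.trace_sub, Matrix.trace_one,
      Fintype.card_fin, hXi, Matrix.trace_mul_comm ((B⁻¹)ᴴ * Y), Matrix.mul_assoc]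
  have hdet : Y.det = X.det * ((B⁻¹)ᴴ * Y * B⁻¹).det := by
    have : Y = Bᴴ * ((B⁻¹)ᴴ * Y * B⁻¹) * B := by
      rw [Matrix.conjTranspose_nonsing_inv]
      simp only [Matrix.mul_assoc]
      rw [Matrix.nonsing_inv_mul _ hBu, Matrix.mul_one, ← Matrix.mul_assoc,
        Matrix.mul_nonsing_inv _ hBHu, Matrix.one_mul]
    conv_lhs => rw [this]
    rw [hB]; simp only [Matrix.det_mul]; ring
  have hlog : Real.log Y.det - Real.log X.det = Real.log ((B⁻¹)ᴴ * Y * B⁻¹).det := by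
    rw [hdet, Real.log_mul hX.det_pos.ne' hM.det_pos.ne']; ring
  rw [hlog, htr]
  refine ⟨(gl_eq_one hM).1, fun h => ?_⟩
  have h1 := (gl_eq_one hM).2 h
  have : Y = Bᴴ * ((B⁻¹)ᴴ * Y * B⁻¹) * B := by
    rw [Matrix.conjTranspose_nonsing_inv]
    simp only [Matrix.mul_assoc]
    rw [Matrix.nonsing_inv_mul _ hBu, Matrix.mul_one, ← Matrix.mul_assoc,
      Matrix.mul_nonsing_inv _ hBHu, Matrix.one_mul]
  rw [this, h1, hB, Matrix.mul_one]

theorem gl_posdef_near {d : ℕ} {X E : Matrix (Fin d) (Fin d) ℝ} (hX : X.PosDef) (hE : E.IsSymm) :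
    ∀ᶠ t : ℝ in nhds 0, (X + t • E).PosDef := by
  have hK : IsCompact (Metric.sphere (0 : Fin d → ℝ) 1) := isCompact_sphere _ _
  have h := hK.eventually_forall_of_forall_eventually (x₀ := (0:ℝ))
    (P := fun t x => 0 < x ⬝ᵥ ((X + t • E) *ᵥ x)) (by
      intro x hx
      have hc : Continuous (fun z : ℝ × (Fin d → ℝ) => z.2 ⬝ᵥ ((X + z.1 • E) *ᵥ z.2)) := by
        fun_prop
      refine hc.continuousAt.eventually (lt_mem_nhds ?_)
      have hx0 : x ≠ 0 := by
        rintro rfl; simp at hx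
      simpa using hX.dotProduct_mulVec_pos hx0)
  filter_upwards [h] with t ht
  refine Matrix.PosDef.of_dotProduct_mulVec_pos ?_ ?_
  · refine hX.1.add ?_
    change (t • E)ᴴ = t • E
    rw [Matrix.conjTranspose_smul, Matrix.conjTranspose_eq_transpose_of_trivial, hE]; simp
  · intro x hx
    have hn : 0 < ‖x‖ := norm_pos_iff.2 hx
    have := ht (‖x‖⁻¹ • x) (by simp [norm_smul, hn.ne'])
    rw [Matrix.mulVec_smul, dotProduct_smul, smul_dotProduct, smul_smul, smul_eq_mul] at this
    simp only [star_trivial]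
    exact (mul_pos_iff_of_pos_left (by positivity)).1 this

theorem gl_off_convex {d : ℕ} (X E : Matrix (Fin d) (Fin d) ℝ) {t : ℝ} (h0 : 0 ≤ t) (h1 : t ≤ 1) :
    offNorm1 (X + t • E) - offNorm1 X ≤ t * (offNorm1 (X + E) - offNorm1 X) := by
  unfold offNorm1
  simp only [← Finset.sum_sub_distrib, Finset.mul_sum]
  refine Finset.sum_le_sum fun i _ => Finset.sum_le_sum fun j _ => ?_
  split_ifs
  · simp
  · simp only [Matrix.add_apply, Matrix.smul_apply, smul_eq_mul]
    have : X i j + t * E i j = (1 - t) * X i j + t * (X i j + E i j) := by ring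
    rw [this]
    have h2 := abs_add_le ((1 - t) * X i j) (t * (X i j + E i j))
    rw [abs_mul, abs_mul, abs_of_nonneg h0, abs_of_nonneg (sub_nonneg.2 h1)] at h2
    linarith

theorem gl_kkt_gen {d : ℕ} {Sh : Matrix (Fin d) (Fin d) ℝ} {S : Set (Fin d × Fin d)} {r : ℝ}
    (hr : 0 < r)
    {X E : Matrix (Fin d) (Fin d) ℝ} (hX : IsPrimalSol Sh S r X) (hE : E.IsSymm)
    (hES : ∀ p ∉ S, E p.1 p.2 = 0) :
    0 ≤ ((Sh - X⁻¹) * E).trace + r * (offNorm1 (X + E) - offNorm1 X) := by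
  obtain ⟨hsym, hpd, hsup, hmin⟩ := hX
  have hcont : Filter.Tendsto (fun t : ℝ => ((Sh - (X + t • E)⁻¹) * E).trace
      + r * (offNorm1 (X + E) - offNorm1 X)) (nhdsWithin 0 (Set.Ioi 0))
      (nhds (((Sh - X⁻¹) * E).trace + r * (offNorm1 (X + E) - offNorm1 X))) := by
    refine Filter.Tendsto.mono_left ?_ nhdsWithin_le_nhds
    have hinv : ContinuousAt (fun t : ℝ => (X + t • E)⁻¹) 0 := by
      have h1 : ContinuousAt (fun t : ℝ => X + t • E) 0 := by fun_prop
      refine ContinuousAt.comp (g := Inv.inv) (f := fun t : ℝ => X + t • E) ?_ h1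
      apply continuousAt_matrix_inv
      simp only [zero_smul, add_zero]
      rw [Ring.inverse_eq_inv']
      exact continuousAt_inv₀ hpd.det_pos.ne'
    have : ContinuousAt (fun t : ℝ => ((Sh - (X + t • E)⁻¹) * E).trace
      + r * (offNorm1 (X + E) - offNorm1 X)) 0 := by
      have h2 : Continuous fun A : Matrix (Fin d) (Fin d) ℝ => ((Sh - A) * E).trace
        + r * (offNorm1 (X + E) - offNorm1 X) := by fun_prop
      exact h2.continuousAt.comp (f := fun t : ℝ => (X + t • E)⁻¹) hinv
    simpa [ContinuousAt] using this
  refine ge_of_tendsto hcont ?_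
  have hle1 : ∀ᶠ t : ℝ in nhdsWithin 0 (Set.Ioi 0), t ≤ 1 :=
    nhdsWithin_le_nhds (Iic_mem_nhds one_pos)
  filter_upwards [nhdsWithin_le_nhds (gl_posdef_near hpd hE), hle1, self_mem_nhdsWithin]
    with t hpt ht1 ht0
  have ht0 : 0 < t := ht0
  have h := hmin (X + t • E) (hsym.add (by
    change (t • E)ᵀ = t • E
    rw [Matrix.transpose_smul, hE])) hpt (fun p hp => by simp [hsup p hp, hES p hp])
  have hld := (gl_logdet hpt hpd).1
  have hoff := gl_off_convex X E ht0.le ht1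
  unfold glassoObj at h
  have e1 : X - (X + t • E) = (-t) • E := by
    rw [neg_smul]; abel
  rw [e1, Matrix.mul_smul, Matrix.trace_smul, smul_eq_mul] at hld
  rw [Matrix.mul_add, Matrix.trace_add, Matrix.mul_smul, Matrix.trace_smul, smul_eq_mul] at h
  rw [Matrix.sub_mul, Matrix.trace_sub]
  have := mul_le_mul_of_nonneg_left hoff hr.le
  have h3 : 0 ≤ t * ((Sh * E).trace - ((X + t • E)⁻¹ * E).trace
      + r * (offNorm1 (X + E) - offNorm1 X)) := by nlinarith
  exact (mul_nonneg_iff_of_pos_left ht0).1 h3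

theorem gl_kkt_off {d : ℕ} {Sh : Matrix (Fin d) (Fin d) ℝ} {S : Set (Fin d × Fin d)} {r : ℝ}
    (hr : 0 < r) (hSh : Sh.IsSymm)
    {X : Matrix (Fin d) (Fin d) ℝ} (hX : IsPrimalSol Sh S r X) {i j : Fin d} (hij : i ≠ j)
    (h1 : (i, j) ∈ S) (h2 : (j, i) ∈ S) :
    |(X⁻¹ - Sh) i j| ≤ r ∧ (X⁻¹ - Sh) i j * X i j = r * |X i j| := by
  have hQs : (Sh - X⁻¹) j i = (Sh - X⁻¹) i j := by
    have : (Sh - X⁻¹)ᵀ = Sh - X⁻¹ := by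
      rw [Matrix.transpose_sub, hSh, Matrix.transpose_nonsing_inv, hX.1]
    conv_rhs => rw [← this]
    rfl
  have key : ∀ v : ℝ, (X⁻¹ - Sh) i j * v ≤ r * (|X i j + v| - |X i j|) := by
    intro v
    have h := gl_kkt_gen (E := v • (Matrix.single i j (1:ℝ) + Matrix.single j i (1:ℝ))) hr hX
      (by
        change _ᵀ = _
        rw [Matrix.transpose_smul, Matrix.transpose_add, Matrix.transpose_single,
          Matrix.transpose_single, add_comm])
      (by
        intro p hp
        have hp1 : ¬ (i = p.1 ∧ j = p.2) := by
          rintro ⟨rfl, rfl⟩; exact hp h1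
        have hp2 : ¬ (j = p.1 ∧ i = p.2) := by
          rintro ⟨rfl, rfl⟩; exact hp h2
        simp [Matrix.single_apply, hp1, hp2])
    have ht : ((Sh - X⁻¹) * (v • (Matrix.single i j (1:ℝ) + Matrix.single j i (1:ℝ)))).trace
        = v * (2 * (Sh - X⁻¹) i j) := by
      rw [Matrix.mul_smul, Matrix.trace_smul, Matrix.mul_add, Matrix.trace_add,
        Matrix.trace_mul_single, Matrix.trace_mul_single, hQs, smul_eq_mul]
      simp only [MulOpposite.op_one, one_smul]; ring
    have ho : offNorm1 (X + v • (Matrix.single i j (1:ℝ) + Matrix.single j i (1:ℝ))) - offNorm1 X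
        = 2 * (|X i j + v| - |X i j|) := by
      have hXs : X j i = X i j := by
        have := hX.1
        conv_rhs => rw [← this]
        rfl
      have e : ∀ a b, (if a = b then 0 else
          |(X + v • (Matrix.single i j (1:ℝ) + Matrix.single j i (1:ℝ))) a b|)
          - (if a = b then 0 else |X a b|)
          = (if i = a ∧ j = b then (|X i j + v| - |X i j|) else 0)
          + (if j = a ∧ i = b then (|X i j + v| - |X i j|) else 0) := by
        intro a b
        simp only [Matrix.add_apply, Matrix.smul_apply, Matrix.single_apply, smul_eq_mul]
        by_cases c1 : i = a ∧ j = b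
        · obtain ⟨rfl, rfl⟩ := c1
          simp [hij, hij.symm]
        · by_cases c2 : j = a ∧ i = b
          · obtain ⟨rfl, rfl⟩ := c2
            simp [hij, hij.symm, hXs]
          · simp [c1, c2]
      unfold offNorm1
      simp only [← Finset.sum_sub_distrib, e, Finset.sum_add_distrib, ite_and]
      simp
      ring
    rw [ht, ho] at h
    have : (Sh - X⁻¹) i j = -(X⁻¹ - Sh) i j := by simp
    rw [this] at h
    linarith
  have k1 := key (-X i j)
  have k2 := key (X i j)
  have e2 : |X i j + X i j| = 2 * |X i j| := by rw [← two_mul, abs_mul]; simp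
  rw [e2] at k2
  simp at k1
  have heq : (X⁻¹ - Sh) i j * X i j = r * |X i j| := by
    simp only [Matrix.sub_apply] at *
    linarith
  refine ⟨?_, heq⟩
  have k3 := key (1 - X i j)
  have k4 := key (-1 - X i j)
  have e3 : X i j + (1 - X i j) = 1 := by ring
  have e4 : X i j + (-1 - X i j) = -1 := by ring
  rw [e3, abs_one] at k3
  rw [e4, abs_neg, abs_one] at k4
  rw [abs_le]
  constructor <;> nlinarith

theorem gl_kkt_diag {d : ℕ} {Sh : Matrix (Fin d) (Fin d) ℝ} {S : Set (Fin d × Fin d)} {r : ℝ}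
    (hr : 0 < r)
    {X : Matrix (Fin d) (Fin d) ℝ} (hX : IsPrimalSol Sh S r X) {i : Fin d}
    (h1 : (i, i) ∈ S) : (X⁻¹ - Sh) i i = 0 := by
  have key : ∀ v : ℝ, 0 ≤ v * (Sh - X⁻¹) i i := by
    intro v
    have h := gl_kkt_gen (E := v • (Matrix.single i i (1:ℝ))) hr hX
      (by
        change _ᵀ = _
        rw [Matrix.transpose_smul, Matrix.transpose_single])
      (by
        intro p hp
        have hp1 : ¬ (i = p.1 ∧ i = p.2) := by
          rintro ⟨h, h'⟩
          apply hp
          have : p = (i, i) := Prod.ext h.symm h'.symm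
          rw [this]; exact h1
        simp [Matrix.single_apply, hp1])
    have ht : ((Sh - X⁻¹) * (v • (Matrix.single i i (1:ℝ)))).trace
        = v * ((Sh - X⁻¹) i i) := by
      rw [Matrix.mul_smul, Matrix.trace_smul, Matrix.trace_mul_single, smul_eq_mul]
      simp
    have ho : offNorm1 (X + v • (Matrix.single i i (1:ℝ))) = offNorm1 X := by
      unfold offNorm1
      refine Finset.sum_congr rfl fun a _ => Finset.sum_congr rfl fun b _ => ?_
      by_cases hab : a = b
      · simp [hab]
      · have : ¬ (i = a ∧ i = b) := by
          rintro ⟨rfl, rfl⟩; exact hab rfl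
        simp [hab, Matrix.single_apply, this]
    rw [ht, ho] at h
    simpa using h
  have k1 := key 1
  have k2 := key (-1)
  simp only [Matrix.sub_apply] at *
  linarith

theorem gl_suff {d : ℕ} {Sh : Matrix (Fin d) (Fin d) ℝ} {r : ℝ} (hr : 0 < r)
    {X Y : Matrix (Fin d) (Fin d) ℝ} (hXs : X.IsSymm) (hX : X.PosDef)
    (hY : IsGlassoSol Sh r Y)
    (hd : ∀ i, (X⁻¹ - Sh) i i = 0)
    (ho : ∀ i j, i ≠ j → |(X⁻¹ - Sh) i j| ≤ r ∧ (X⁻¹ - Sh) i j * X i j = r * |X i j|) :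
    X = Y := by
  have hmin := hY.2.2 X hXs hX
  have hYX := gl_logdet hX hY.2.1
  symm
  apply hYX.2
  have hsub : ((X⁻¹ - Sh) * (Y - X)).trace ≤ r * (offNorm1 Y - offNorm1 X) := by
    have hsym : (Y - X)ᵀ = Y - X := by rw [Matrix.transpose_sub, hY.1, hXs]
    rw [← hsym]
    unfold offNorm1
    simp only [Matrix.trace, Matrix.diag, Matrix.mul_apply, Matrix.transpose_apply,
      ← Finset.sum_sub_distrib, Finset.mul_sum]
    refine Finset.sum_le_sum fun i _ => Finset.sum_le_sum fun j _ => ?_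
    split_ifs with h
    · subst h; simp [hd]
    · obtain ⟨ha, hb⟩ := ho i j h
      have : (X⁻¹ - Sh) i j * Y i j ≤ r * |Y i j| := by
        refine (le_abs_self _).trans ?_
        rw [abs_mul]
        exact mul_le_mul_of_nonneg_right ha (abs_nonneg _)
      rw [Matrix.sub_apply Y X, mul_sub, mul_sub]
      linarith
  unfold glassoObj at hmin
  rw [Matrix.sub_mul, Matrix.trace_sub, Matrix.mul_sub Sh, Matrix.trace_sub] at hsub
  linarith

theorem gl_row_mul {d : ℕ} {A B : Matrix (Fin d) (Fin d) ℝ} {a b : ℝ}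
    (hA : ∀ i, ∑ j, |A i j| ≤ a) (hB : ∀ i, ∑ j, |B i j| ≤ b) (hb : 0 ≤ b) :
    ∀ i, ∑ j, |(A * B) i j| ≤ a * b := by
  intro i
  calc ∑ j, |(A * B) i j| ≤ ∑ j, ∑ k, |A i k| * |B k j| := by
        refine Finset.sum_le_sum fun j _ => ?_
        rw [Matrix.mul_apply]
        refine (Finset.abs_sum_le_sum_abs _ _).trans (le_of_eq ?_)
        simp [abs_mul]
    _ = ∑ k, |A i k| * ∑ j, |B k j| := by
        rw [Finset.sum_comm]; simp [Finset.mul_sum]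
    _ ≤ ∑ k, |A i k| * b := Finset.sum_le_sum fun k _ =>
        mul_le_mul_of_nonneg_left (hB k) (abs_nonneg _)
    _ = (∑ k, |A i k|) * b := by rw [Finset.sum_mul]
    _ ≤ a * b := mul_le_mul_of_nonneg_right (hA i) hb

theorem gl_max_mul {d : ℕ} {A B : Matrix (Fin d) (Fin d) ℝ} {a b : ℝ}
    (hA : ∀ i, ∑ j, |A i j| ≤ a) (hB : ∀ i j, |B i j| ≤ b) (hb : 0 ≤ b) :
    ∀ i j, |(A * B) i j| ≤ a * b := by
  intro i j
  rw [Matrix.mul_apply]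
  calc _ ≤ ∑ k, |A i k| * |B k j| := by
        refine (Finset.abs_sum_le_sum_abs _ _).trans (le_of_eq ?_)
        simp [abs_mul]
    _ ≤ ∑ k, |A i k| * b := Finset.sum_le_sum fun k _ =>
        mul_le_mul_of_nonneg_left (hB k j) (abs_nonneg _)
    _ = (∑ k, |A i k|) * b := by rw [Finset.sum_mul]
    _ ≤ a * b := mul_le_mul_of_nonneg_right (hA i) hb

theorem gl_row_le_kappa {d : ℕ} (A : Matrix (Fin d) (Fin d) ℝ) (i : Fin d) :
    ∑ j, |A i j| ≤ kappaSigma A :=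
  le_ciSup (f := fun i => ∑ j, |A i j|) (Set.finite_range _).bddAbove i

theorem gl_entry_le_dist {d : ℕ} (A B : Matrix (Fin d) (Fin d) ℝ) (i j : Fin d) :
    |A i j - B i j| ≤ linfDist A B :=
  le_ciSup (f := fun p : Fin d × Fin d => |A p.1 p.2 - B p.1 p.2|)
    (Set.finite_range _).bddAbove (i, j)

theorem gl_deg_le {d : ℕ} (A : Matrix (Fin d) (Fin d) ℝ) (i : Fin d) :
    {j | A i j ≠ 0}.ncard ≤ degTheta A :=
  le_ciSup (f := fun i => {j | A i j ≠ 0}.ncard) (Set.finite_range _).bddAbove i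

/-- Incoherence step. -/
theorem gl_incoh {d : ℕ} {Sig : Matrix (Fin d) (Fin d) ℝ} (hs : Sig.IsSymm)
    {S : Set (Fin d × Fin d)} (hInv : IsUnit (gammaSS Sig S).det)
    {D : Matrix (Fin d) (Fin d) ℝ} (hD : ∀ p ∉ S, D p.1 p.2 = 0) {c : ℝ}
    (hc : ∀ p ∈ S, |(Sig * D * Sig) p.1 p.2| ≤ c) (e : Fin d × Fin d) :
    |(Sig * D * Sig) e.1 e.2| ≤ incohVal Sig S e * c := by
  have hG : ∀ e : Fin d × Fin d, (Sig * D * Sig) e.1 e.2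
      = ∑ p : S, bigGamma Sig e p * D p.1.1 p.1.2 := by
    intro e
    have h1 : (Sig * D * Sig) e.1 e.2 = ∑ p : Fin d × Fin d, bigGamma Sig e p * D p.1 p.2 := by
      rw [Fintype.sum_prod_type, Matrix.mul_apply]
      simp only [Matrix.mul_apply, Finset.sum_mul, bigGamma, Matrix.of_apply]
      rw [Finset.sum_comm]
      refine Finset.sum_congr rfl fun a _ => Finset.sum_congr rfl fun b _ => ?_
      rw [← hs.apply e.2 b]; ring
    rw [h1, ← Finset.sum_subset (Finset.subset_univ (Finset.univ.filter (· ∈ S)))]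
    · exact (Finset.sum_subtype (p := (· ∈ S)) _ (by simp) _)
    · intro x _ hx
      rw [hD x (by simpa using hx), mul_zero]
  let DS : S → ℝ := fun p => D p.1.1 p.1.2
  let GS : S → ℝ := fun p => (Sig * D * Sig) p.1.1 p.1.2
  have hGS : gammaSS Sig S *ᵥ DS = GS := by
    funext p
    exact (hG p).symm
  have hDS : DS = (gammaSS Sig S)⁻¹ *ᵥ GS := by
    rw [← hGS, Matrix.mulVec_mulVec, Matrix.nonsing_inv_mul _ hInv, Matrix.one_mulVec]
  have he : (Sig * D * Sig) e.1 e.2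
      = (Matrix.vecMul (fun p : S => bigGamma Sig e p) (gammaSS Sig S)⁻¹) ⬝ᵥ GS := by
    rw [← Matrix.dotProduct_mulVec, ← hDS, hG e]; rfl
  rw [he]
  unfold incohVal dotProduct
  rw [Finset.sum_mul]
  refine (Finset.abs_sum_le_sum_abs _ _).trans (Finset.sum_le_sum fun p _ => ?_)
  rw [abs_mul]
  exact mul_le_mul_of_nonneg_left (hc p p.2) (abs_nonneg _)

/-- Remainder bound. -/
theorem gl_remainder {d : ℕ} [NeZero d] {Sig T : Matrix (Fin d) (Fin d) ℝ} (hs : Sig.IsSymm)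
    (hSu : IsUnit Sig.det) (hTu : IsUnit T.det) {k m : ℝ} (hk : 0 < k) (hm : 0 < m)
    (hrow : ∀ i, ∑ j, |Sig i j| ≤ k)
    (hmax : ∀ i j, |(T - Sig⁻¹) i j| ≤ (3 * k * m)⁻¹)
    (hDrow : ∀ i, ∑ j, |(T - Sig⁻¹) i j| ≤ (3 * k)⁻¹) :
    ∀ i j, |(T⁻¹ - Sig + Sig * (T - Sig⁻¹) * Sig) i j| ≤ k / (6 * m) := by
  set D := T - Sig⁻¹ with hD
  have hSP : Sig * D * T⁻¹ = Sig - T⁻¹ := by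
    rw [hD, Matrix.mul_sub, Matrix.mul_nonsing_inv _ hSu, Matrix.sub_mul, Matrix.mul_assoc,
      Matrix.mul_nonsing_inv _ hTu, Matrix.mul_one, Matrix.one_mul]
  have hPS : T⁻¹ * D * Sig = Sig - T⁻¹ := by
    rw [hD, Matrix.mul_sub, Matrix.nonsing_inv_mul _ hTu, Matrix.sub_mul, Matrix.mul_assoc,
      Matrix.nonsing_inv_mul _ hSu, Matrix.mul_one, Matrix.one_mul]
  have hR : T⁻¹ - Sig + Sig * D * Sig = (Sig * D * T⁻¹) * (D * Sig) := by
    have : (Sig * D * T⁻¹) * (D * Sig) = Sig * D * (T⁻¹ * D * Sig) := by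
      simp only [Matrix.mul_assoc]
    rw [this, hPS, Matrix.mul_sub (Sig * D) Sig, hSP]; abel
  have hDS : ∀ i, ∑ j, |(D * Sig) i j| ≤ (3 * k)⁻¹ * k := gl_row_mul hDrow hrow hk.le
  have h13 : (3 * k)⁻¹ * k = 1 / 3 := by field_simp
  have hSD : ∀ i, ∑ j, |(Sig * D) i j| ≤ k * (3 * k)⁻¹ := gl_row_mul hrow hDrow (by positivity)
  rw [h13] at hDS
  rw [mul_comm, h13] at hSD
  have hK0 : 0 ≤ kappaSigma T⁻¹ :=
    le_trans (Finset.sum_nonneg fun _ _ => abs_nonneg _) (gl_row_le_kappa T⁻¹ 0)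
  have hP : kappaSigma T⁻¹ ≤ k + kappaSigma T⁻¹ * (1 / 3) := by
    refine ciSup_le fun i => ?_
    have h1 := gl_row_mul (gl_row_le_kappa T⁻¹) hDS (by norm_num) i
    have e : T⁻¹ = Sig - T⁻¹ * (D * Sig) := by
      rw [← Matrix.mul_assoc, hPS]; abel
    calc ∑ j, |T⁻¹ i j| = ∑ j, |(Sig - T⁻¹ * (D * Sig)) i j| := by rw [← e]
      _ ≤ ∑ j, (|Sig i j| + |(T⁻¹ * (D * Sig)) i j|) :=
          Finset.sum_le_sum fun j _ => by rw [Matrix.sub_apply]; exact abs_sub _ _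
      _ ≤ _ := by rw [Finset.sum_add_distrib]; exact add_le_add (hrow i) h1
  have hP' : ∀ i, ∑ j, |T⁻¹ i j| ≤ 3 / 2 * k := fun i =>
    (gl_row_le_kappa T⁻¹ i).trans (by linarith)
  have hA : ∀ i, ∑ j, |(Sig * D * T⁻¹) i j| ≤ 1 / 3 * (3 / 2 * k) :=
    gl_row_mul hSD hP' (by positivity)
  have hB : ∀ i j, |(D * Sig) i j| ≤ k * (3 * k * m)⁻¹ := by
    intro i j
    have hT : (D * Sig) i j = (Sig * Dᵀ) j i := by
      rw [← Matrix.transpose_apply (Sig * Dᵀ), Matrix.transpose_mul, Matrix.transpose_transpose, hs]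
    rw [hT]
    exact gl_max_mul hrow (fun a b => hmax b a) (by positivity) j i
  intro i j
  rw [hR]
  refine (gl_max_mul hA hB (by positivity) i j).trans (le_of_eq ?_)
  field_simp; norm_num

/-- Intermediate step in the proof of the ℓ∞-bound for the graphical lasso: under
the incoherence condition, the primal accuracy bound
`ℓ∞(Θ, Θ̃_r) ≤ (3 κ_Σ deg Θ)⁻¹`, and the event bound
`max{ℓ∞(Σ,Σ̂), κ_Σ/(6 deg Θ)} ≤ α·r/8`, the primal-dual witness construction
succeeds: `Θ̃_r = Θ̂_r`. -/
theorem stmt_16 {d : ℕ} (hd : 2 ≤ d)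
    (Sig : Matrix (Fin d) (Fin d) ℝ) (hSig_symm : Sig.IsSymm) (hSig_pd : Sig.PosDef)
    (Sighat : Matrix (Fin d) (Fin d) ℝ) (hSighat_symm : Sighat.IsSymm)
    (α r : ℝ) (hα : α ∈ Set.Ioc (0 : ℝ) 1) (hr : 0 < r)
    (ThetaHat ThetaTilde : Matrix (Fin d) (Fin d) ℝ)
    (hHat : IsGlassoSol Sighat r ThetaHat)
    (hTilde : IsPrimalSol Sighat (supp Sig⁻¹) r ThetaTilde)
    (hInv : IsUnit (gammaSS Sig (supp Sig⁻¹)).det)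
    (hIncoh : ∀ e ∈ (supp Sig⁻¹)ᶜ, incohVal Sig (supp Sig⁻¹) e ≤ 1 - α)
    (hTildeBound : linfDist Sig⁻¹ ThetaTilde ≤
      (3 * kappaSigma Sig * (degTheta Sig⁻¹ : ℝ))⁻¹)
    (hEvent : max (linfDist Sig Sighat)
        (kappaSigma Sig / (6 * (degTheta Sig⁻¹ : ℝ))) ≤ α * r / 8) :
    ThetaTilde = ThetaHat := by
  have : NeZero d := ⟨by omega⟩
  obtain ⟨hα0, hα1⟩ := hα
  have hSu : IsUnit Sig.det := (Matrix.isUnit_iff_isUnit_det _).1 hSig_pd.isUnit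
  have hThpd : (Sig⁻¹).PosDef := hSig_pd.inv
  have hThs : (Sig⁻¹).IsSymm := by
    change _ᵀ = _
    rw [Matrix.transpose_nonsing_inv, hSig_symm]
  have hTpd := hTilde.2.1
  have hTu : IsUnit ThetaTilde.det := (Matrix.isUnit_iff_isUnit_det _).1 hTpd.isUnit
  set k := kappaSigma Sig with hkdef
  set m : ℝ := (degTheta Sig⁻¹ : ℝ) with hmdef
  have hk : 0 < k := by
    refine lt_of_lt_of_le ?_ (gl_row_le_kappa Sig 0)
    refine lt_of_lt_of_le (abs_pos.2 (hSig_pd.diag_pos (i := 0)).ne') ?_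
    exact Finset.single_le_sum (f := fun j => |Sig 0 j|) (fun _ _ => abs_nonneg _)
      (Finset.mem_univ 0)
  have hm : 0 < m := by
    have h1 := gl_deg_le Sig⁻¹ 0
    have h2 : 0 < {j | Sig⁻¹ 0 j ≠ 0}.ncard :=
      (Set.ncard_pos (Set.toFinite _)).2 ⟨0, (hThpd.diag_pos (i := 0)).ne'⟩
    rw [hmdef]
    exact_mod_cast lt_of_lt_of_le h2 h1
  have hDsupp : ∀ p ∉ supp Sig⁻¹, (ThetaTilde - Sig⁻¹) p.1 p.2 = 0 := by
    intro p hp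
    have h1 := hTilde.2.2.1 p hp
    have h2 : Sig⁻¹ p.1 p.2 = 0 := by
      by_contra h; exact hp h
    rw [Matrix.sub_apply, h1, h2, sub_zero]
  have hmax : ∀ i j, |(ThetaTilde - Sig⁻¹) i j| ≤ (3 * k * m)⁻¹ := by
    intro i j
    rw [Matrix.sub_apply, abs_sub_comm]
    exact (gl_entry_le_dist _ _ i j).trans hTildeBound
  have hDrow : ∀ i, ∑ j, |(ThetaTilde - Sig⁻¹) i j| ≤ (3 * k)⁻¹ := by
    intro i
    have h1 : ∀ j, |(ThetaTilde - Sig⁻¹) i j| ≤ if Sig⁻¹ i j ≠ 0 then (3 * k * m)⁻¹ else 0 := by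
      intro j
      split_ifs with h
      · exact hmax i j
      · rw [hDsupp (i, j) h, abs_zero]
    refine (Finset.sum_le_sum fun j _ => h1 j).trans ?_
    rw [← Finset.sum_filter, Finset.sum_const, nsmul_eq_mul]
    have h2 : ((Finset.univ.filter fun j => Sig⁻¹ i j ≠ 0).card : ℝ) ≤ m := by
      have := gl_deg_le Sig⁻¹ i
      rw [Set.ncard_eq_toFinset_card'] at this
      rw [hmdef]
      refine le_trans (le_of_eq ?_) (Nat.cast_le.2 this)
      congr 2
      ext j; simp
    calc _ ≤ m * (3 * k * m)⁻¹ := mul_le_mul_of_nonneg_right h2 (by positivity)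
      _ = (3 * k)⁻¹ := by field_simp
  have hR := gl_remainder hSig_symm hSu hTu hk hm (gl_row_le_kappa Sig) hmax hDrow
  have hE1 := (le_max_left _ _).trans hEvent
  have hE2 := (le_max_right _ _).trans hEvent
  have hW : ∀ i j, |Sig i j - Sighat i j| ≤ α * r / 8 :=
    fun i j => (gl_entry_le_dist _ _ i j).trans hE1
  have hR' : ∀ i j, |(ThetaTilde⁻¹ - Sig + Sig * (ThetaTilde - Sig⁻¹) * Sig) i j| ≤ α * r / 8 :=
    fun i j => (hR i j).trans hE2
  have hdiagS : ∀ i, (i, i) ∈ supp Sig⁻¹ := fun i => (hThpd.diag_pos (i := i)).ne'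
  have hsymS : ∀ i j, (i, j) ∈ supp Sig⁻¹ → (j, i) ∈ supp Sig⁻¹ := by
    intro i j h
    change Sig⁻¹ j i ≠ 0
    rw [hThs.apply]; exact h
  have hQd : ∀ i, (ThetaTilde⁻¹ - Sighat) i i = 0 := fun i => gl_kkt_diag hr hTilde (hdiagS i)
  have hQo : ∀ i j, i ≠ j → (i, j) ∈ supp Sig⁻¹ →
      |(ThetaTilde⁻¹ - Sighat) i j| ≤ r ∧
        (ThetaTilde⁻¹ - Sighat) i j * ThetaTilde i j = r * |ThetaTilde i j| :=
    fun i j hij h => gl_kkt_off hr hSighat_symm hTilde hij h (hsymS i j h)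
  have hrel : ∀ i j, (Sig * (ThetaTilde - Sig⁻¹) * Sig) i j =
      (ThetaTilde⁻¹ - Sig + Sig * (ThetaTilde - Sig⁻¹) * Sig) i j
      + (Sig i j - Sighat i j) - (ThetaTilde⁻¹ - Sighat) i j := by
    intro i j
    rw [Matrix.add_apply, Matrix.sub_apply, Matrix.sub_apply]; ring
  have hGS : ∀ p ∈ supp Sig⁻¹, |(Sig * (ThetaTilde - Sig⁻¹) * Sig) p.1 p.2| ≤ α * r / 4 + r := by
    rintro ⟨i, j⟩ hp
    have hq : |(ThetaTilde⁻¹ - Sighat) i j| ≤ r := by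
      by_cases hij : i = j
      · subst hij; rw [hQd, abs_zero]; exact hr.le
      · exact (hQo i j hij hp).1
    have a1 := abs_le.1 hq
    have a2 := abs_le.1 (hW i j)
    have a3 := abs_le.1 (hR' i j)
    have a4 := hrel i j
    change |(Sig * (ThetaTilde - Sig⁻¹) * Sig) i j| ≤ _
    rw [abs_le]
    constructor <;> linarith [a1.1, a1.2, a2.1, a2.2, a3.1, a3.2]
  refine gl_suff hr hTilde.1 hTpd hHat hQd fun i j hij => ?_
  by_cases hS : (i, j) ∈ supp Sig⁻¹
  · exact hQo i j hij hS
  · have h0 : ThetaTilde i j = 0 := hTilde.2.2.1 (i, j) hS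
    refine ⟨?_, by rw [h0]; simp⟩
    have hin := gl_incoh hSig_symm hInv hDsupp hGS (i, j)
    have hc : 0 ≤ α * r / 4 + r := by positivity
    have hG : |(Sig * (ThetaTilde - Sig⁻¹) * Sig) i j| ≤ (1 - α) * (α * r / 4 + r) :=
      hin.trans (mul_le_mul_of_nonneg_right (hIncoh (i, j) hS) hc)
    have a1 := abs_le.1 hG
    have a2 := abs_le.1 (hW i j)
    have a3 := abs_le.1 (hR' i j)
    have a4 := hrel i j
    have hfin : α * r / 4 + (1 - α) * (α * r / 4 + r) ≤ r := by
      nlinarith [mul_pos hα0 hr, mul_pos hα0 (mul_pos hα0 hr)]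
    rw [abs_le]
    constructor <;> linarith [a1.1, a1.2, a2.1, a2.2, a3.1, a3.2]
end
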